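/- arXiv:cs/0102007 — 2 statements merged into one kernel-verified Lean document; each statement's English description precedes it below -/
import Mathlib

section
/- Let G be a finite simple triconnected planar graph, let ℳ = 𝒞₁,…,𝒞_q be a sequence of families of vertex subsets of G, and let Φ be any plane embedding of G. Then G satisfies ℳ if and only if for every i ∈ {1,…,q}, ACF(Φ,𝒞ᵢ) ≠ ∅ (where each 𝒞ᵢ is regarded as a vf-family of the plane graph (G,Φ) whose vf-sets contain only vertices). -/
open Set Topology

/-- A plane embedding of a simple graph `G`: an injective placement of the vertices in the
plane together with, for each edge, an arc (the image of an injective continuous path) whose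
endpoints are the images of the endpoints of the edge, such that two distinct arcs intersect
only in images of common endpoints and an arc meets the image of a vertex only if that vertex
is an endpoint of the corresponding edge. -/
structure PlaneEmbedding {V : Type*} (G : SimpleGraph V) where
  vmap : V → ℝ × ℝ
  vmap_inj : Function.Injective vmap
  arc : G.edgeSet → Set (ℝ × ℝ)
  arc_path : ∀ e : G.edgeSet, ∃ f : unitInterval → ℝ × ℝ,
    Continuous f ∧ Function.Injective f ∧ Set.range f = arc e ∧
    ∃ u v : V, (e : Sym2 V) = s(u, v) ∧ f 0 = vmap u ∧ f 1 = vmap v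
  arc_inter : ∀ e e' : G.edgeSet, e ≠ e' →
    arc e ∩ arc e' ⊆ vmap '' {x : V | x ∈ (e : Sym2 V) ∧ x ∈ (e' : Sym2 V)}
  vmap_mem_arc : ∀ (e : G.edgeSet) (x : V), vmap x ∈ arc e → x ∈ (e : Sym2 V)

namespace PlaneEmbedding

variable {V : Type*} {G : SimpleGraph V}

/-- The union of all arcs of the embedding. -/
def drawing (Φ : PlaneEmbedding G) : Set (ℝ × ℝ) :=
  ⋃ e : G.edgeSet, Φ.arc e

/-- The faces of the embedding: connected components of the complement of the drawing. -/
def IsFace (Φ : PlaneEmbedding G) (F : Set (ℝ × ℝ)) : Prop :=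
  ∃ p ∈ Φ.drawingᶜ, F = connectedComponentIn Φ.drawingᶜ p

/-- The vertex `v` lies on the boundary of the face `F`. -/
def OnFace (Φ : PlaneEmbedding G) (F : Set (ℝ × ℝ)) (v : V) : Prop :=
  Φ.vmap v ∈ frontier F

/-- The embedding satisfies a family `C` of vertex subsets: some face has on its boundary
at least one vertex from each set in `C`. -/
def SatisfiesFam (Φ : PlaneEmbedding G) (C : Set (Set V)) : Prop :=
  ∃ F : Set (ℝ × ℝ), Φ.IsFace F ∧ ∀ U ∈ C, ∃ v ∈ U, Φ.OnFace F v

end PlaneEmbedding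

/-- A graph is planar if it has a plane embedding. -/
def Planar {V : Type*} (G : SimpleGraph V) : Prop :=
  Nonempty (PlaneEmbedding G)
/-- A cut vertex: a vertex whose removal increases the number of connected components. -/
def IsCutVertex {V : Type*} (G : SimpleGraph V) (w : V) : Prop :=
  Nat.card G.ConnectedComponent < Nat.card ((G.induce {v : V | v ≠ w}).ConnectedComponent)

/-- A graph is biconnected if it is connected, has at least two vertices and no cut vertex. -/
def Biconnected {V : Type*} (G : SimpleGraph V) : Prop :=
  G.Connected ∧ 2 ≤ Nat.card V ∧ ∀ w : V, ¬ IsCutVertex G w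

/-- A graph is triconnected if it is biconnected, has at least three vertices, and the removal
of any two vertices cannot disconnect it. -/
def Triconnected {V : Type*} (G : SimpleGraph V) : Prop :=
  Biconnected G ∧ 3 ≤ Nat.card V ∧
    ∀ u v : V, u ≠ v → ((G.induce {x : V | x ≠ u ∧ x ≠ v}).Connected)
/-- A vf-set of a plane graph: a set of vertices together with a set of faces. -/
structure VFSet {V : Type*} {G : SimpleGraph V} (Φ : PlaneEmbedding G) where
  verts : Set V
  faces : Set (Set (ℝ × ℝ))
  faces_isFace : ∀ F ∈ faces, Φ.IsFace F

/-- `Λ_v(H, 𝒟)`: the vertices common to all vf-sets of the vf-family `D`. -/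
def lamV {V : Type*} {G : SimpleGraph V} {Φ : PlaneEmbedding G} {ι : Type*}
    (D : ι → VFSet Φ) : Set V :=
  ⋂ i, (D i).verts

/-- `Λ_f(H, 𝒟)`: the faces `F` such that for each vf-set `S` of the vf-family `D`, either
`F ∈ S` or the boundary of `F` contains a vertex of `S − Λ_v(H, 𝒟)`. -/
def lamF {V : Type*} {G : SimpleGraph V} {Φ : PlaneEmbedding G} {ι : Type*}
    (D : ι → VFSet Φ) : Set (Set (ℝ × ℝ)) :=
  {F | Φ.IsFace F ∧ ∀ i, F ∈ (D i).faces ∨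
    ∃ v ∈ (D i).verts, v ∉ lamV D ∧ Φ.OnFace F v}

/-- `ACF(H, 𝒟) = Λ_v(H, 𝒟) ∪ Λ_f(H, 𝒟)`, as a vf-set. -/
def ACF {V : Type*} {G : SimpleGraph V} {Φ : PlaneEmbedding G} {ι : Type*}
    (D : ι → VFSet Φ) : VFSet Φ :=
  ⟨lamV D, lamF D, fun _ hF => hF.1⟩

/-- The size of a vf-set: the number of its vertices plus the number of its faces. -/
noncomputable def vfsize {V : Type*} {G : SimpleGraph V} {Φ : PlaneEmbedding G}
    (S : VFSet Φ) : ℕ :=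
  S.verts.ncard + S.faces.ncard

open Set Topology

/-- `f` has a continuous logarithm on `K`. -/
def HasLog {X : Type*} [TopologicalSpace X] (f : X → ℂ) (K : Set X) : Prop :=
  ∃ g : X → ℂ, ContinuousOn g K ∧ ∀ z ∈ K, Complex.exp (g z) = f z

theorem HasLog.of_slit {X : Type*} [TopologicalSpace X] {f : X → ℂ} {K : Set X}
    (hf : ContinuousOn f K) (h : ∀ z ∈ K, f z ∈ Complex.slitPlane) : HasLog f K :=
  ⟨fun z => Complex.log (f z), hf.clog h, fun z hz =>
    Complex.exp_log (Complex.slitPlane_ne_zero (h z hz))⟩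

theorem HasLog.mul {X : Type*} [TopologicalSpace X] {f g : X → ℂ} {K : Set X}
    (hf : HasLog f K) (hg : HasLog g K) : HasLog (fun z => f z * g z) K := by
  obtain ⟨a, ha, ha'⟩ := hf
  obtain ⟨b, hb, hb'⟩ := hg
  exact ⟨fun z => a z + b z, ha.add hb, fun z hz => by rw [Complex.exp_add, ha' z hz, hb' z hz]⟩

theorem HasLog.inv {X : Type*} [TopologicalSpace X] {f : X → ℂ} {K : Set X}
    (hf : HasLog f K) : HasLog (fun z => (f z)⁻¹) K := by
  obtain ⟨a, ha, ha'⟩ := hf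
  exact ⟨fun z => - a z, ha.neg, fun z hz => by rw [Complex.exp_neg, ha' z hz]⟩

theorem HasLog.congr {X : Type*} [TopologicalSpace X] {f g : X → ℂ} {K : Set X}
    (hf : HasLog f K) (h : ∀ z ∈ K, f z = g z) : HasLog g K := by
  obtain ⟨a, ha, ha'⟩ := hf
  exact ⟨a, ha, fun z hz => by rw [ha' z hz, h z hz]⟩

theorem HasLog.mono {X : Type*} [TopologicalSpace X] {f : X → ℂ} {K L : Set X}
    (hf : HasLog f K) (h : L ⊆ K) : HasLog f L := by
  obtain ⟨a, ha, ha'⟩ := hf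
  exact ⟨a, ha.mono h, fun z hz => ha' z (h hz)⟩

/-- Two continuous logarithms on a preconnected set differ by a constant. -/
theorem log_diff_const {X : Type*} [TopologicalSpace X] {a b : X → ℂ} {K : Set X}
    (hK : IsPreconnected K) (ha : ContinuousOn a K) (hb : ContinuousOn b K)
    (h : ∀ z ∈ K, Complex.exp (a z) = Complex.exp (b z)) {x y : X} (hx : x ∈ K) (hy : y ∈ K) :
    a x - b x = a y - b y := by
  have hhn : ∀ z ∈ K, ∃ n : ℤ, a z - b z = n * (2 * Real.pi * Complex.I) := by
    intro z hz
    have := Complex.exp_eq_exp_iff_exists_int.1 (h z hz)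
    obtain ⟨n, hn⟩ := this
    exact ⟨n, by rw [hn]; ring⟩
  have hc : ContinuousOn (fun z => (a z - b z).im / (2 * Real.pi)) K := by
    apply ContinuousOn.div_const
    exact Complex.continuous_im.comp_continuousOn (ha.sub hb)
  have hval : ∀ z ∈ K, ∀ n : ℤ, a z - b z = n * (2 * Real.pi * Complex.I) →
      (a z - b z).im / (2 * Real.pi) = n := by
    intro z hz n hn
    rw [hn]
    simp [Complex.mul_im]
  have himg := (hK.image _ hc).ordConnected
  obtain ⟨n, hn⟩ := hhn x hx
  obtain ⟨m, hm⟩ := hhn y hy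
  have key : ∀ n m : ℤ, ∀ x ∈ K, ∀ y ∈ K, a x - b x = n * (2 * Real.pi * Complex.I) →
      a y - b y = m * (2 * Real.pi * Complex.I) → ¬ n < m := by
    intro n m x hx y hy hn hm hlt
    have h1 := hval x hx n hn
    have h2 := hval y hy m hm
    have : (n : ℝ) + 1/2 ∈ (fun z => (a z - b z).im / (2 * Real.pi)) '' K := by
      apply himg.out ⟨x, hx, h1⟩ ⟨y, hy, h2⟩
      have : (n : ℝ) + 1 ≤ m := by exact_mod_cast hlt
      constructor <;> linarith
    obtain ⟨z, hz, hz'⟩ := this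
    obtain ⟨k, hk⟩ := hhn z hz
    have h3 := hval z hz k hk
    simp only at hz'
    rw [h3] at hz'
    have : (2 * k : ℝ) = 2 * n + 1 := by linarith
    have : (2 * k : ℤ) = 2 * n + 1 := by exact_mod_cast this
    omega
  have e : n = m := le_antisymm (not_lt.1 (key m n y hy x hx hm hn))
    (not_lt.1 (key n m x hx y hy hn hm))
  rw [hn, hm, e]

/-- Gluing logarithms. -/
theorem HasLog.glue {X : Type*} [TopologicalSpace X] {f : X → ℂ} {A B : Set X}
    (hA : IsClosed A) (hB : IsClosed B) (hAB : IsPreconnected (A ∩ B))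
    (h1 : HasLog f A) (h2 : HasLog f B) : HasLog f (A ∪ B) := by
  classical
  obtain ⟨a, ha, ha'⟩ := h1
  obtain ⟨b, hb, hb'⟩ := h2
  have hex : ∃ c : ℂ, Complex.exp c = 1 ∧ ∀ z ∈ A ∩ B, a z = b z + c := by
    rcases (A ∩ B).eq_empty_or_nonempty with h | ⟨x, hx⟩
    · exact ⟨0, by simp, by simp [h]⟩
    · refine ⟨a x - b x, ?_, fun z hz => ?_⟩
      · rw [Complex.exp_sub, ha' x hx.1, hb' x hx.2, div_self]
        rw [← ha' x hx.1]; exact Complex.exp_ne_zero _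
      · have := log_diff_const hAB (ha.mono inter_subset_left) (hb.mono inter_subset_right)
          (fun z hz => by rw [ha' z hz.1, hb' z hz.2]) hz hx
        rw [← this]; ring
  obtain ⟨c, hc, hcc⟩ := hex
  refine ⟨fun z => if z ∈ A then a z else b z + c, ?_, ?_⟩
  · apply ContinuousOn.union_of_isClosed _ _ hA hB
    · exact ha.congr (fun z hz => by simp [hz])
    · refine (hb.add continuousOn_const : ContinuousOn (fun z => b z + c) B).congr (fun z hz => ?_)
      by_cases h : z ∈ A
      · simp [h, hcc z ⟨h, hz⟩]
      · simp [h]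
  · intro z hz
    by_cases h : z ∈ A
    · simp [h, ha' z h]
    · have : z ∈ B := hz.resolve_left h
      simp [h, Complex.exp_add, hc, hb' z this]

theorem div_mem_slit {x y : ℂ} (hy : y ≠ 0) (h : ‖x - y‖ < ‖y‖) : x / y ∈ Complex.slitPlane := by
  have : ‖x / y - 1‖ < 1 := by
    rw [div_sub_one hy, norm_div, div_lt_one (norm_pos_iff.2 hy)]
    exact h
  apply Complex.ball_one_subset_slitPlane
  simpa [dist_eq_norm] using this

/-- On a compact set star-shaped at `0`, every nonvanishing function has a logarithm. -/
theorem HasLog.of_star {E : Type*} [NormedAddCommGroup E] [NormedSpace ℝ E] {K : Set E}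
    (hK : IsCompact K) (hs : StarConvex ℝ 0 K) {f : E → ℂ}
    (hf : ContinuousOn f K) (h0 : ∀ z ∈ K, f z ≠ 0) : HasLog f K := by
  rcases K.eq_empty_or_nonempty with rfl | hne
  · exact ⟨0, continuousOn_empty _, by simp⟩
  have hmem : ∀ x ∈ K, ∀ t : ℝ, t ∈ Icc (0:ℝ) 1 → t • x ∈ K := by
    intro x hx t ht
    exact hs.smul_mem hx ht.1 ht.2
  obtain ⟨x0, hx0, hmin⟩ := hK.exists_isMinOn hne hf.norm
  have hδ : 0 < ‖f x0‖ := norm_pos_iff.2 (h0 x0 hx0)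
  have huc : UniformContinuousOn f K := hK.uniformContinuousOn_of_continuous hf
  rw [Metric.uniformContinuousOn_iff] at huc
  obtain ⟨η, hη, huc⟩ := huc _ hδ
  obtain ⟨R, hR⟩ := hK.isBounded.exists_norm_le
  obtain ⟨n, hn⟩ := exists_nat_gt (R / η)
  have hR0 : 0 ≤ R := (norm_nonneg _).trans (hR x0 hx0)
  have hnpos : (0:ℝ) < n := lt_of_le_of_lt (by positivity) hn
  have main : ∀ k : ℕ, k ≤ n → HasLog (fun x => f (((k:ℝ) / n) • x)) K := by
    intro k
    induction k with
    | zero =>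
      intro _
      refine ⟨fun _ => Complex.log (f 0), continuousOn_const, fun z hz => ?_⟩
      have : f 0 ≠ 0 := by
        apply h0; simpa using hmem x0 hx0 0 (by simp)
      simp [Complex.exp_log this]
    | succ k ih =>
      intro hk
      have ih := ih (by omega)
      have hk1 : ((k:ℝ) + 1) ≤ n := by exact_mod_cast hk
      have m1 : (k:ℝ) / n ∈ Icc (0:ℝ) 1 := ⟨by positivity, by rw [div_le_one hnpos]; linarith⟩
      have m2 : ((k + 1 : ℕ):ℝ) / n ∈ Icc (0:ℝ) 1 :=
        ⟨by positivity, by rw [div_le_one hnpos]; push_cast; linarith⟩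
      have c1 : ∀ t : ℝ, t ∈ Icc (0:ℝ) 1 → ContinuousOn (fun x => f (t • x)) K := fun t ht =>
        hf.comp (continuous_const_smul t).continuousOn (fun x hx => hmem x hx t ht)
      have : HasLog (fun x => f ((((k+1:ℕ):ℝ) / n) • x) / f (((k:ℝ) / n) • x)) K := by
        apply HasLog.of_slit
        · exact (c1 _ m2).div (c1 _ m1) (fun x hx => h0 _ (hmem x hx _ m1))
        · intro x hx
          apply div_mem_slit (h0 _ (hmem x hx _ m1))
          have : ‖f x0‖ ≤ ‖f (((k:ℝ) / n) • x)‖ := hmin (hmem x hx _ m1)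
          refine lt_of_lt_of_le ?_ this
          rw [← dist_eq_norm]
          apply huc _ (hmem x hx _ m2) _ (hmem x hx _ m1)
          rw [dist_eq_norm, ← sub_smul, norm_smul]
          have e : ((k+1:ℕ):ℝ)/n - (k:ℝ)/n = 1 / n := by push_cast; ring
          rw [e, Real.norm_of_nonneg (by positivity), div_mul_eq_mul_div, one_mul, div_lt_iff₀ hnpos]
          rw [div_lt_iff₀ hη] at hn
          calc ‖x‖ ≤ R := hR x hx
            _ < n * η := hn
            _ = η * n := by ring
      refine (ih.mul this).congr (fun x hx => ?_)
      have := h0 _ (hmem x hx _ m1)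
      field_simp
  refine (main n le_rfl).congr (fun x hx => ?_)
  rw [div_self hnpos.ne', one_smul]

/-- No continuous logarithm on a circle. -/
theorem no_log_sphere (p : ℂ) {R : ℝ} (hR : 0 < R) :
    ¬ HasLog (fun z => z - p) (Metric.sphere p R) := by
  rintro ⟨g, hg, hg'⟩
  have hm : ∀ t : ℝ, p + R * Complex.exp (t * Complex.I) ∈ Metric.sphere p R := by
    intro t
    simp [Complex.norm_exp_ofReal_mul_I, abs_of_pos hR]
  have hc : Continuous (fun t : ℝ => p + R * Complex.exp (t * Complex.I)) := by fun_prop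
  have := log_diff_const (a := fun t : ℝ => g (p + R * Complex.exp (t * Complex.I)))
    (b := fun t : ℝ => (Real.log R : ℂ) + t * Complex.I) (K := univ) isPreconnected_univ
    (hg.comp hc.continuousOn (fun t _ => hm t)) (by fun_prop)
    (fun t _ => by
      rw [hg' _ (hm t), Complex.exp_add, ← Complex.ofReal_exp, Real.exp_log hR]; ring)
    (mem_univ 0) (mem_univ (2 * Real.pi))
  simp only [Complex.ofReal_zero, zero_mul, Complex.exp_zero, Complex.ofReal_mul,
    Complex.ofReal_ofNat, Complex.exp_two_pi_mul_I] at this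
  have h2 : (2 * Real.pi * Complex.I : ℂ) = 0 := by linear_combination this
  exact Complex.two_pi_I_ne_zero h2

open Set Topology

/-- `p` and `q` are not separated by `K`. -/
def NS {X : Type*} [TopologicalSpace X] (K : Set X) (p q : X) : Prop :=
  ∃ S : Set X, IsPreconnected S ∧ p ∈ S ∧ q ∈ S ∧ S ⊆ Kᶜ

theorem NS.symm {X : Type*} [TopologicalSpace X] {K : Set X} {p q : X} (h : NS K p q) :
    NS K q p := by
  obtain ⟨S, h1, h2, h3, h4⟩ := h
  exact ⟨S, h1, h3, h2, h4⟩

theorem NS.trans {X : Type*} [TopologicalSpace X] {K : Set X} {p q r : X} (h : NS K p q)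
    (h' : NS K q r) : NS K p r := by
  obtain ⟨S, h1, h2, h3, h4⟩ := h
  obtain ⟨T, k1, k2, k3, k4⟩ := h'
  exact ⟨S ∪ T, h1.union q h3 k2 k1, Or.inl h2, Or.inr k3, union_subset h4 k4⟩

theorem NS.mono {X : Type*} [TopologicalSpace X] {K L : Set X} {p q : X} (h : NS K p q)
    (hL : L ⊆ K) : NS L p q := by
  obtain ⟨S, h1, h2, h3, h4⟩ := h
  exact ⟨S, h1, h2, h3, h4.trans (compl_subset_compl.2 hL)⟩

theorem NS.mem {X : Type*} [TopologicalSpace X] {K : Set X} {p q : X} (h : NS K p q) :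
    q ∈ connectedComponentIn Kᶜ p := by
  obtain ⟨S, h1, h2, h3, h4⟩ := h
  exact h1.subset_connectedComponentIn h2 h4 h3

theorem NS.of_mem {X : Type*} [TopologicalSpace X] {K : Set X} {p q : X} (hp : p ∉ K)
    (h : q ∈ connectedComponentIn Kᶜ p) : NS K p q :=
  ⟨_, isPreconnected_connectedComponentIn, mem_connectedComponentIn hp, h,
    connectedComponentIn_subset _ _⟩

/-- Closed-in-complement: a closure point of a component off `K` is in the component. -/
theorem closure_comp {X : Type*} [TopologicalSpace X] [LocallyConnectedSpace X] {K : Set X}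
    (hK : IsClosed K) {p x : X} (hx : x ∈ closure (connectedComponentIn Kᶜ p)) (hxK : x ∉ K) :
    x ∈ connectedComponentIn Kᶜ p := by
  have ho : IsOpen (connectedComponentIn Kᶜ x) := hK.isOpen_compl.connectedComponentIn
  rw [mem_closure_iff] at hx
  obtain ⟨y, hy1, hy2⟩ := hx _ ho (mem_connectedComponentIn hxK)
  rw [connectedComponentIn_eq hy2, ← connectedComponentIn_eq hy1]
  exact mem_connectedComponentIn hxK

theorem frontier_comp {X : Type*} [TopologicalSpace X] [LocallyConnectedSpace X] {K : Set X}
    (hK : IsClosed K) {p : X} : frontier (connectedComponentIn Kᶜ p) ⊆ K := by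
  intro x hx
  by_contra h
  have ho : IsOpen (connectedComponentIn Kᶜ p) := hK.isOpen_compl.connectedComponentIn
  rw [ho.frontier_eq] at hx
  exact hx.2 (closure_comp hK hx.1 h)

theorem isPreconnected_outer (R : ℝ) :
    IsPreconnected (Metric.closedBall (0:ℂ) R)ᶜ := by
  have : (Metric.closedBall (0:ℂ) R)ᶜ =
      (fun x : ℝ × ℝ => (x.1 : ℂ) * Complex.exp (x.2 * Complex.I)) '' (Ioi R ×ˢ univ) := by
    ext z
    simp only [mem_compl_iff, Metric.mem_closedBall, dist_zero_right, not_le, mem_image, mem_prod,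
      mem_Ioi, mem_univ, and_true, Prod.exists]
    constructor
    · intro h
      exact ⟨‖z‖, z.arg, h, Complex.norm_mul_exp_arg_mul_I z⟩
    · rintro ⟨a, b, ha, rfl⟩
      rw [norm_mul, Complex.norm_exp_ofReal_mul_I, mul_one, Complex.norm_real, Real.norm_eq_abs]
      exact lt_of_lt_of_le ha (le_abs_self a)
  rw [this]
  apply (isPreconnected_Ioi.prod isPreconnected_univ).image
  fun_prop

theorem crit_core {K : Set ℂ} (hK : IsCompact K) {p q : ℂ} (hp : p ∉ K) (hq : q ∉ K)
    (hb : Bornology.IsBounded (connectedComponentIn Kᶜ p))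
    (hqU : q ∉ connectedComponentIn Kᶜ p)
    (hl : HasLog (fun z => (z - p) / (z - q)) K) : False := by
  classical
  set U := connectedComponentIn Kᶜ p with hU
  have hpU : p ∈ U := mem_connectedComponentIn hp
  have hfr : frontier U ⊆ K := frontier_comp hK.isClosed
  obtain ⟨g, hg, hg'⟩ := hl
  obtain ⟨h, hh⟩ := ContinuousMap.exists_restrict_eq (Y := ℂ) hK.isClosed
    ⟨K.domRestrict g, hg.domRestrict⟩
  have hh' : ∀ z ∈ K, h z = g z := fun z hz => by
    have := DFunLike.congr_fun hh ⟨z, hz⟩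
    exact this
  obtain ⟨R, hR0, hR⟩ := hb.subset_ball_lt 0 p
  have hFc : Continuous (fun z => if z ∈ U then (z - q) * Complex.exp (h z) else z - p) := by
    apply Continuous.if
    · intro a ha
      have haK := hfr ha
      rw [hh' a haK, hg' a haK]
      have : a - q ≠ 0 := sub_ne_zero.2 (fun e => hq (e ▸ haK))
      field_simp
    · exact (continuous_id.sub continuous_const).mul (Complex.continuous_exp.comp h.continuous)
    · fun_prop
  have hF0 : ∀ z, (if z ∈ U then (z - q) * Complex.exp (h z) else z - p) ≠ 0 := by
    intro z
    split_ifs with hz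
    · exact mul_ne_zero (sub_ne_zero.2 (fun e => hqU (e ▸ hz))) (Complex.exp_ne_zero _)
    · exact sub_ne_zero.2 (fun e => hz (e ▸ hpU))
  have hlog := HasLog.of_star (isCompact_closedBall (0:ℂ) R)
    ((convex_closedBall (0:ℂ) R).starConvex (Metric.mem_closedBall_self hR0.le))
    (hFc.comp (continuous_const.add continuous_id : Continuous (fun z : ℂ => p + z))).continuousOn
    (fun z _ => hF0 _)
  apply no_log_sphere 0 hR0
  refine (hlog.mono Metric.sphere_subset_closedBall).congr (fun z hz => ?_)
  have : p + z ∉ U := fun hmem => by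
    have := hR hmem
    simp at this hz
    linarith
  simp [this]

theorem crit {K : Set ℂ} (hK : IsCompact K) {p q : ℂ} (hp : p ∉ K) (hq : q ∉ K) :
    NS K p q ↔ HasLog (fun z => (z - p) / (z - q)) K := by
  constructor
  · rintro ⟨S, hS, hpS, hqS, hSK⟩
    have hnear : ∀ a ∉ K, ∃ ε > 0, ∀ b, dist b a < ε → b ∉ K ∧
        HasLog (fun z => (z - b) / (z - a)) K := by
      intro a ha
      obtain ⟨ε, hε, hb⟩ := Metric.isOpen_iff.1 hK.isClosed.isOpen_compl a ha
      refine ⟨ε, hε, fun b hb' => ⟨hb hb', ?_⟩⟩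
      have hza : ∀ z ∈ K, z - a ≠ 0 := fun z hz => sub_ne_zero.2 (fun e => ha (e ▸ hz))
      apply HasLog.of_slit
      · exact ContinuousOn.div (by fun_prop) (by fun_prop) hza
      · intro z hz
        apply div_mem_slit (hza z hz)
        have h1 : ε ≤ dist z a := by
          by_contra hlt
          exact hb (not_le.1 hlt) hz
        rw [← dist_eq_norm]
        have : dist (z - b) (z - a) = dist b a := dist_sub_left z b a
        rw [this, ← dist_eq_norm]
        linarith
    have hne : ∀ a ∉ K, ∀ z ∈ K, z - a ≠ 0 := fun a ha z hz =>
      sub_ne_zero.2 (fun e => ha (e ▸ hz))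
    have htr : ∀ a ∉ K, ∀ b ∉ K, ∀ c ∉ K, HasLog (fun z => (z - a) / (z - b)) K →
        HasLog (fun z => (z - b) / (z - c)) K → HasLog (fun z => (z - a) / (z - c)) K := by
      intro a ha b hb c hc h1 h2
      refine (h1.mul h2).congr (fun z hz => ?_)
      have := hne a ha z hz
      have := hne b hb z hz
      have := hne c hc z hz
      field_simp
    have hsy : ∀ a b, HasLog (fun z => (z - a) / (z - b)) K →
        HasLog (fun z => (z - b) / (z - a)) K := by
      intro a b h
      exact h.inv.congr (fun z hz => by rw [inv_div])
    have o1 : IsOpen {a | a ∉ K ∧ HasLog (fun z => (z - a) / (z - q)) K} := by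
      rw [Metric.isOpen_iff]
      rintro a ⟨ha, hla⟩
      obtain ⟨ε, hε, h⟩ := hnear a ha
      exact ⟨ε, hε, fun b hb => ⟨(h b hb).1, htr b (h b hb).1 a ha q hq (h b hb).2 hla⟩⟩
    have o2 : IsOpen {a | a ∉ K ∧ ¬ HasLog (fun z => (z - a) / (z - q)) K} := by
      rw [Metric.isOpen_iff]
      rintro a ⟨ha, hla⟩
      obtain ⟨ε, hε, h⟩ := hnear a ha
      refine ⟨ε, hε, fun b hb => ⟨(h b hb).1, fun hlb => hla ?_⟩⟩
      exact htr a ha b (h b hb).1 q hq (hsy _ _ (h b hb).2) hlb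
    have := hS.subset_left_of_subset_union o1 o2
      (by rw [Set.disjoint_left]; rintro a ⟨_, h⟩ ⟨_, h'⟩; exact h' h)
      (fun a ha => by
        by_cases h : HasLog (fun z => (z - a) / (z - q)) K
        · exact Or.inl ⟨hSK ha, h⟩
        · exact Or.inr ⟨hSK ha, h⟩)
      ⟨q, hqS, hq, ⟨fun _ => 0, continuousOn_const, fun z hz => by
        rw [Complex.exp_zero]; exact (div_self (hne q hq z hz)).symm⟩⟩
    exact (this hpS).2
  · intro hl
    by_contra hns
    have hqU : q ∉ connectedComponentIn Kᶜ p := fun h => hns (NS.of_mem hp h)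
    have hpU : p ∉ connectedComponentIn Kᶜ q := fun h => hns (NS.of_mem hq h).symm
    by_cases b1 : Bornology.IsBounded (connectedComponentIn Kᶜ p)
    · exact crit_core hK hp hq b1 hqU hl
    by_cases b2 : Bornology.IsBounded (connectedComponentIn Kᶜ q)
    · exact crit_core hK hq hp b2 hpU (hl.inv.congr (fun z hz => by rw [inv_div]))
    obtain ⟨R, hR0, hR⟩ := hK.isBounded.subset_closedBall_lt 0 0
    have hx : ∀ a, ¬ Bornology.IsBounded (connectedComponentIn Kᶜ a) →
        ∃ x ∈ connectedComponentIn Kᶜ a, x ∈ (Metric.closedBall (0:ℂ) R)ᶜ := by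
      intro a ha
      by_contra hc
      push Not at hc
      exact ha ((Metric.isBounded_closedBall (x := (0:ℂ)) (r := R)).subset
        (fun x hx => by simpa using hc x hx))
    obtain ⟨x, hx1, hx2⟩ := hx p b1
    obtain ⟨y, hy1, hy2⟩ := hx q b2
    have hxy : NS K x y := ⟨_, isPreconnected_outer R, hx2, hy2, compl_subset_compl.2 hR⟩
    exact hns (((NS.of_mem hp hx1).trans hxy).trans (NS.of_mem hq hy1).symm)

theorem janC {A B : Set ℂ} (hA : IsCompact A) (hB : IsCompact B) (hAB : IsPreconnected (A ∩ B))
    {p q : ℂ} (h1 : NS A p q) (h2 : NS B p q) : NS (A ∪ B) p q := by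
  have hpA : p ∉ A := by obtain ⟨S, _, h, _, h'⟩ := h1; exact h' h
  have hpB : p ∉ B := by obtain ⟨S, _, h, _, h'⟩ := h2; exact h' h
  have hqA : q ∉ A := by obtain ⟨S, _, _, h, h'⟩ := h1; exact h' h
  have hqB : q ∉ B := by obtain ⟨S, _, _, h, h'⟩ := h2; exact h' h
  rw [crit (hA.union hB) (by simp [*]) (by simp [*])]
  exact HasLog.glue hA.isClosed hB.isClosed hAB ((crit hA hpA hqA).1 h1) ((crit hB hpB hqB).1 h2)

/-- Every nonvanishing continuous function on `K` has a logarithm. -/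
def HasLogs {X : Type*} [TopologicalSpace X] (K : Set X) : Prop :=
  ∀ f : X → ℂ, ContinuousOn f K → (∀ z ∈ K, f z ≠ 0) → HasLog f K

theorem HasLogs.glue {X : Type*} [TopologicalSpace X] {A B : Set X}
    (hA : IsClosed A) (hB : IsClosed B) (hAB : IsPreconnected (A ∩ B))
    (h1 : HasLogs A) (h2 : HasLogs B) : HasLogs (A ∪ B) := fun f hf h0 =>
  HasLog.glue hA hB hAB (h1 f (hf.mono subset_union_left) (fun z hz => h0 z (Or.inl hz)))
    (h2 f (hf.mono subset_union_right) (fun z hz => h0 z (Or.inr hz)))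

theorem HasLogs.ns {A : Set ℂ} (hA : IsCompact A) (h : HasLogs A) {p q : ℂ} (hp : p ∉ A)
    (hq : q ∉ A) : NS A p q := by
  have hne : ∀ a ∉ A, ∀ z ∈ A, z - a ≠ 0 := fun a ha z hz =>
      sub_ne_zero.2 (fun e => ha (e ▸ hz))
  rw [crit hA hp hq]
  exact h _ (ContinuousOn.div (by fun_prop) (by fun_prop) (hne q hq))
    (fun z hz => div_ne_zero (hne p hp z hz) (hne q hq z hz))

open Set Topology

theorem jctC {A B : Set ℂ} (hA : IsCompact A) (hB : IsCompact B) (cA : IsPreconnected A)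
    (cB : IsPreconnected B) (lA : HasLogs A) (lB : HasLogs B) {a b : ℂ} (hab : a ≠ b)
    (hI : A ∩ B = {a, b}) : ∃ p q, p ∉ A ∪ B ∧ q ∉ A ∪ B ∧ ¬ NS (A ∪ B) p q := by
  by_contra hcon
  push Not at hcon
  have haA : a ∈ A ∩ B := by rw [hI]; simp
  have hbA : b ∈ A ∩ B := by rw [hI]; simp
  have hba : b - a ≠ 0 := sub_ne_zero.2 hab.symm
  have hJ := hA.union hB
  set w : ℂ → ℂ := fun z => (2 * z - a - b) / (b - a) with hw
  have hwc : Continuous w := by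
    simp only [hw]; fun_prop
  have wa : w a = -1 := by simp only [hw]; field_simp; ring
  have wb : w b = 1 := by simp only [hw]; field_simp; ring
  set F : ℝ → ℂ → ℂ := fun t z => w z - t * Complex.I with hF
  have hFc : ∀ t, Continuous (F t) := fun t => by simp only [hF]; fun_prop
  set m : ℝ → ℂ := fun t => (a + b + t * Complex.I * (b - a)) / 2 with hm
  have hFm : ∀ t z, F t z = 2 / (b - a) * (z - m t) := by
    intro t z
    simp only [hF, hm, hw]
    field_simp
    ring
  have hF0 : ∀ t z, F t z = 0 ↔ z = m t := by
    intro t z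
    rw [hFm, mul_eq_zero, sub_eq_zero]
    simp [hba]
  have hFa : ∀ t, F t a = -1 - t * Complex.I := fun t => by simp only [hF, wa]
  have hFb : ∀ t, F t b = 1 - t * Complex.I := fun t => by simp only [hF, wb]
  have hFa0 : ∀ t, F t a ≠ 0 := fun t h => by
    rw [hFa] at h; have := congrArg Complex.re h; simp at this
  have hFb0 : ∀ t, F t b ≠ 0 := fun t h => by
    rw [hFb] at h; have := congrArg Complex.re h; simp at this
  have hlogJ : ∀ t, m t ∉ A ∪ B → HasLog (F t) (A ∪ B) := by
    intro t ht
    obtain ⟨R, hR0, hR⟩ := hJ.isBounded.subset_ball_lt 0 0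
    have hq : (R : ℂ) ∉ A ∪ B := fun h => by
      have := hR h
      simp at this
      linarith [le_abs_self R]
    have h1 := (crit hJ ht hq).1 (hcon _ _ ht hq)
    have h2 : HasLog (fun z => (R : ℂ) - z) (A ∪ B) := by
      apply HasLog.of_slit (by fun_prop)
      intro z hz
      left
      have := hR hz
      simp at this
      simp
      linarith [Complex.re_le_norm z]
    have h3 : HasLog (fun _ => - 2 / (b - a)) (A ∪ B) := by
      refine ⟨fun _ => Complex.log (- 2 / (b - a)), continuousOn_const, fun z _ => ?_⟩
      exact Complex.exp_log (div_ne_zero (by norm_num) hba)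
    refine ((h1.mul h2).mul h3).congr (fun z hz => ?_)
    have : z - R ≠ 0 := sub_ne_zero.2 (fun e => hq (e ▸ hz))
    rw [hFm]
    field_simp
    ring
  set Del : Set ℂ → ℝ → ℂ → Prop := fun S t d => ∃ g : ℂ → ℂ, ContinuousOn g S ∧
    (∀ z ∈ S, Complex.exp (g z) = F t z) ∧ d = g b - g a with hDel
  have exA : ∀ S, HasLogs S → ∀ t, m t ∉ S → ∃ d, Del S t d := by
    intro S hS t ht
    obtain ⟨g, h1, h2⟩ := hS (F t) (hFc t).continuousOn
      (fun z hz h => ht ((hF0 t z).1 h ▸ hz))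
    exact ⟨_, g, h1, h2, rfl⟩
  have unA : ∀ S, IsPreconnected S → a ∈ S → b ∈ S → ∀ t d d', Del S t d → Del S t d' → d = d' := by
    rintro S hS ha hb t d d' ⟨g, h1, h2, rfl⟩ ⟨g', h1', h2', rfl⟩
    have := log_diff_const hS h1 h1' (fun z hz => by rw [h2 z hz, h2' z hz]) ha hb
    linear_combination -this
  have notin : ∀ S t d, Del S t d → m t ∉ S := by
    rintro S t d ⟨g, h1, h2, rfl⟩ hmS
    have := h2 _ hmS
    rw [(hF0 t _).2 rfl] at this
    exact Complex.exp_ne_zero _ this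
  have unAB : ∀ t d d', Del A t d → Del B t d' → d = d' := by
    intro t d d' h h'
    obtain ⟨g, h1, h2⟩ := hlogJ t (by
      rintro (h3 | h3)
      · exact notin _ _ _ h h3
      · exact notin _ _ _ h' h3)
    have e1 := unA A cA haA.1 hbA.1 t d (g b - g a) h
      ⟨g, h1.mono subset_union_left, fun z hz => h2 z (Or.inl hz), rfl⟩
    have e2 := unA B cB haA.2 hbA.2 t d' (g b - g a) h'
      ⟨g, h1.mono subset_union_right, fun z hz => h2 z (Or.inr hz), rfl⟩
    rw [e1, e2]
  have ex : ∀ t, ∃ d, Del A t d ∨ Del B t d := by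
    intro t
    by_cases h : m t ∈ A
    · have : m t ∉ B := fun h' => by
        have : m t ∈ A ∩ B := ⟨h, h'⟩
        rw [hI] at this
        rcases this with h | h
        · exact hFa0 t ((hF0 t a).2 h.symm)
        · exact hFb0 t ((hF0 t b).2 (mem_singleton_iff.1 h).symm)
      obtain ⟨d, hd⟩ := exA B lB t this
      exact ⟨d, Or.inr hd⟩
    · obtain ⟨d, hd⟩ := exA A lA t h
      exact ⟨d, Or.inl hd⟩
  have un : ∀ t d d', (Del A t d ∨ Del B t d) → (Del A t d' ∨ Del B t d') → d = d' := by
    rintro t d d' (h | h) (h' | h')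
    · exact unA A cA haA.1 hbA.1 t d d' h h'
    · exact unAB t d d' h h'
    · exact (unAB t d' d h' h).symm
    · exact unA B cB haA.2 hbA.2 t d d' h h'
  choose d hd using ex
  have step : ∀ S, IsCompact S → a ∈ S → b ∈ S → ∀ t0 d0, Del S t0 d0 → ∃ ε > 0, ∀ t, |t - t0| < ε →
      Del S t (d0 + Complex.log (F t b / F t0 b) - Complex.log (F t a / F t0 a)) := by
    rintro S hS ha hb t0 d0 hD
    have hnot := notin _ _ _ hD
    obtain ⟨g, h1, h2, rfl⟩ := hD
    have hne : ∀ z ∈ S, F t0 z ≠ 0 := fun z hz h => hnot ((hF0 t0 z).1 h ▸ hz)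
    obtain ⟨x0, hx0, hmin⟩ := hS.exists_isMinOn ⟨a, ha⟩ (hFc t0).continuousOn.norm
    refine ⟨‖F t0 x0‖, norm_pos_iff.2 (hne x0 hx0), fun t ht => ?_⟩
    have hsl : ∀ z ∈ S, F t z / F t0 z ∈ Complex.slitPlane := by
      intro z hz
      apply div_mem_slit (hne z hz)
      have e : F t z - F t0 z = -((t - t0 : ℝ) : ℂ) * Complex.I := by
        simp only [hF]; push_cast; ring
      rw [e, norm_mul, norm_neg, Complex.norm_I, mul_one, Complex.norm_real, Real.norm_eq_abs]
      exact lt_of_lt_of_le ht (hmin hz)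
    refine ⟨fun z => g z + Complex.log (F t z / F t0 z), ?_, ?_, by ring⟩
    · exact h1.add (((hFc t).continuousOn.div (hFc t0).continuousOn hne).clog hsl)
    · intro z hz
      rw [Complex.exp_add, h2 z hz, Complex.exp_log (Complex.slitPlane_ne_zero (hsl z hz))]
      have := hne z hz
      field_simp
  have hdc : Continuous d := by
    rw [continuous_iff_continuousAt]
    intro t0
    have : ∃ ε > 0, ∀ t, |t - t0| < ε →
        d t = (d t0 + Complex.log (F t b / F t0 b) - Complex.log (F t a / F t0 a)) := by
      rcases hd t0 with h | h
      · obtain ⟨ε, hε, H⟩ := step A hA haA.1 hbA.1 t0 _ h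
        exact ⟨ε, hε, fun t ht => un t _ _ (hd t) (Or.inl (H t ht))⟩
      · obtain ⟨ε, hε, H⟩ := step B hB haA.2 hbA.2 t0 _ h
        exact ⟨ε, hε, fun t ht => un t _ _ (hd t) (Or.inr (H t ht))⟩
    obtain ⟨ε, hε, H⟩ := this
    have hcont : ContinuousAt (fun t => d t0 + Complex.log (F t b / F t0 b) -
        Complex.log (F t a / F t0 a)) t0 := by
      have c1 : Continuous (fun t => F t b / F t0 b) := by
        simp only [hF]; fun_prop
      have c2 : Continuous (fun t => F t a / F t0 a) := by
        simp only [hF]; fun_prop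
      refine (continuousAt_const.add (c1.continuousAt.clog ?_)).sub (c2.continuousAt.clog ?_)
      · rw [div_self (hFb0 t0)]; exact Complex.one_mem_slitPlane
      · rw [div_self (hFa0 t0)]; exact Complex.one_mem_slitPlane
    refine hcont.congr ?_
    filter_upwards [Metric.ball_mem_nhds t0 hε] with t ht
    exact (H t (by simpa [Real.dist_eq] using ht)).symm
  have hexp : ∀ t, Complex.exp (d t) = F t b / F t a := by
    intro t
    rcases hd t with ⟨g, _, h2, e⟩ | ⟨g, _, h2, e⟩
    · rw [e, Complex.exp_sub, h2 _ haA.1, h2 _ hbA.1]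
    · rw [e, Complex.exp_sub, h2 _ haA.2, h2 _ hbA.2]
  have hs1 : ∀ t : ℝ, (1 - t * Complex.I : ℂ) ∈ Complex.slitPlane := fun t => by left; simp
  have hs2 : ∀ t : ℝ, (1 + t * Complex.I : ℂ) ∈ Complex.slitPlane := fun t => by left; simp
  obtain ⟨T, hT0, hT⟩ : ∃ T : ℝ, 0 < T ∧ ∀ z ∈ A, |(w z).im| < T := by
    obtain ⟨R, hR0, hR⟩ := (hA.image hwc).isBounded.subset_ball_lt 0 0
    refine ⟨R, hR0, fun z hz => ?_⟩
    have := hR (mem_image_of_mem _ hz)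
    simp at this
    linarith [Complex.abs_im_le_norm (w z)]
  have key := log_diff_const (a := d)
    (b := fun t : ℝ => Complex.log (1 - t * Complex.I) - Complex.log (1 + t * Complex.I) +
      Real.pi * Complex.I) (K := univ) isPreconnected_univ hdc.continuousOn
    (by
      apply Continuous.continuousOn
      refine (Continuous.sub (Continuous.clog (by fun_prop) hs1)
        (Continuous.clog (by fun_prop) hs2)).add continuous_const)
    (fun t _ => by
      rw [hexp, Complex.exp_add, Complex.exp_sub,
        Complex.exp_log (Complex.slitPlane_ne_zero (hs1 t)),
        Complex.exp_log (Complex.slitPlane_ne_zero (hs2 t)), Complex.exp_pi_mul_I, hFa, hFb]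
      have := Complex.slitPlane_ne_zero (hs2 t)
      have e : (-1 - t * Complex.I : ℂ) = -(1 + t * Complex.I) := by ring
      rw [e, div_neg]; ring)
    (mem_univ T) (mem_univ (-T))
  have dT : d T = Complex.log (T + Complex.I) - Complex.log (T - Complex.I) := by
    apply un T _ _ (hd T)
    left
    refine ⟨fun z => Complex.log (Complex.I * F T z) + Complex.log (-Complex.I), ?_, ?_, ?_⟩
    · refine ContinuousOn.add (ContinuousOn.clog ?_ ?_) continuousOn_const
      · exact (continuous_const.mul (hFc T)).continuousOn
      · intro z hz
        left
        have := hT z hz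
        simp [hF]
        linarith [le_abs_self (w z).im]
    · intro z hz
      have h0 : F T z ≠ 0 := fun h => by
        have h1 := congrArg Complex.im h
        simp [hF] at h1
        linarith [hT z hz, le_abs_self (w z).im]
      rw [Complex.exp_add, Complex.exp_log (mul_ne_zero Complex.I_ne_zero h0),
        Complex.exp_log (neg_ne_zero.2 Complex.I_ne_zero)]
      linear_combination -F T z * Complex.I_mul_I
    · beta_reduce
      rw [hFa, hFb]
      have e1 : Complex.I * (1 - T * Complex.I) = T + Complex.I := by
        linear_combination -T * Complex.I_mul_I
      have e2 : Complex.I * (-1 - T * Complex.I) = T - Complex.I := by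
        linear_combination -T * Complex.I_mul_I
      rw [e1, e2]; ring
  have dT' : d (-T) = Complex.log (T - Complex.I) - Complex.log (T + Complex.I) := by
    apply un (-T) _ _ (hd (-T))
    left
    refine ⟨fun z => Complex.log (-Complex.I * F (-T) z) + Complex.log Complex.I, ?_, ?_, ?_⟩
    · refine ContinuousOn.add (ContinuousOn.clog ?_ ?_) continuousOn_const
      · exact (continuous_const.mul (hFc (-T))).continuousOn
      · intro z hz
        left
        have := hT z hz
        simp [hF]
        linarith [neg_abs_le (w z).im]
    · intro z hz
      have h0 : F (-T) z ≠ 0 := fun h => by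
        have h1 := congrArg Complex.im h
        simp [hF] at h1
        linarith [hT z hz, neg_abs_le (w z).im]
      rw [Complex.exp_add, Complex.exp_log (mul_ne_zero (neg_ne_zero.2 Complex.I_ne_zero) h0),
        Complex.exp_log Complex.I_ne_zero]
      linear_combination -F (-T) z * Complex.I_mul_I
    · beta_reduce
      rw [hFa, hFb]
      have e1 : -Complex.I * (1 - (-T : ℝ) * Complex.I) = T - Complex.I := by
        push_cast
        linear_combination -T * Complex.I_mul_I
      have e2 : -Complex.I * (-1 - (-T : ℝ) * Complex.I) = T + Complex.I := by
        push_cast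
        linear_combination -T * Complex.I_mul_I
      rw [e1, e2]; ring
  rw [dT, dT'] at key
  have kim := congrArg Complex.im key
  simp only [Complex.sub_im, Complex.add_im, Complex.log_im, Complex.ofReal_neg, neg_mul,
    sub_neg_eq_add, ← sub_eq_add_neg] at kim
  have a1 : 0 ≤ Complex.arg (T + Complex.I) := Complex.arg_nonneg_iff.2 (by simp)
  have a2 : Complex.arg (T - Complex.I) < 0 := Complex.arg_neg_iff.2 (by simp)
  have a3 : 0 ≤ Complex.arg (1 + T * Complex.I) := Complex.arg_nonneg_iff.2 (by simp [hT0.le])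
  have a4 : Complex.arg (1 - T * Complex.I) < 0 := Complex.arg_neg_iff.2 (by simp [hT0])
  linarith

open Set Topology

theorem HasLogs.image {X Y : Type*} [TopologicalSpace X] [TopologicalSpace Y] [T2Space Y]
    [Nonempty X] {K : Set X} (hK : IsCompact K) (h : HasLogs K) {f : X → Y}
    (hf : ContinuousOn f K) (hi : InjOn f K) : HasLogs (f '' K) := by
  intro g hg h0
  obtain ⟨l, hl, hl'⟩ := h (g ∘ f) (hg.comp hf (mapsTo_image f K))
    (fun z hz => h0 _ (mem_image_of_mem f hz))
  have hinv : ContinuousOn (Function.invFunOn f K) (f '' K) := by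
    rw [continuousOn_iff_isClosed]
    intro t ht
    refine ⟨f '' (K ∩ t), ((hK.inter_right ht).image_of_continuousOn
      (hf.mono inter_subset_left)).isClosed, ?_⟩
    ext y
    constructor
    · rintro ⟨h1, x, hx, rfl⟩
      simp only [mem_preimage, hi.leftInvOn_invFunOn hx] at h1
      exact ⟨⟨x, ⟨hx, h1⟩, rfl⟩, x, hx, rfl⟩
    · rintro ⟨⟨x, ⟨hx, h1⟩, rfl⟩, -⟩
      refine ⟨?_, x, hx, rfl⟩
      simpa only [mem_preimage, hi.leftInvOn_invFunOn hx] using h1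
  refine ⟨l ∘ Function.invFunOn f K, hl.comp hinv ?_, ?_⟩
  · rintro _ ⟨x, hx, rfl⟩
    rw [hi.leftInvOn_invFunOn hx]; exact hx
  · rintro _ ⟨x, hx, rfl⟩
    simp only [Function.comp, hi.leftInvOn_invFunOn hx]
    exact hl' x hx

theorem HasLogs.Icc (a b : ℝ) : HasLogs (Icc a b) := by
  rcases le_or_gt a b with hab | hab
  · have h1 : HasLogs (Set.Icc (0:ℝ) (b - a)) := fun f hf h0 => by
      apply HasLog.of_star isCompact_Icc _ hf h0
      exact (convex_Icc _ _).starConvex ⟨le_refl _, sub_nonneg.2 hab⟩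
    have h2 := h1.image isCompact_Icc (f := fun x => x + a) (by fun_prop)
      (fun x _ y _ h => by simpa using h)
    simpa using h2
  · rw [Set.Icc_eq_empty (not_le.2 hab)]
    exact fun f _ _ => ⟨0, continuousOn_empty _, by simp⟩

theorem HasLogs.singleton {X : Type*} [TopologicalSpace X] (x : X) : HasLogs ({x} : Set X) := by
  intro f hf h0
  exact ⟨fun _ => Complex.log (f x), continuousOn_const, fun z hz => by
    rw [mem_singleton_iff.1 hz, Complex.exp_log (h0 x rfl)]⟩

theorem NS.image {X Y : Type*} [TopologicalSpace X] [TopologicalSpace Y] (e : X ≃ₜ Y) {K : Set X}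
    {p q : X} (h : NS K p q) : NS (e '' K) (e p) (e q) := by
  obtain ⟨S, h1, h2, h3, h4⟩ := h
  refine ⟨e '' S, h1.image _ e.continuous.continuousOn, mem_image_of_mem _ h2,
    mem_image_of_mem _ h3, ?_⟩
  rw [← image_compl_eq e.bijective]
  exact image_mono h4

theorem NS.image_iff {X Y : Type*} [TopologicalSpace X] [TopologicalSpace Y] (e : X ≃ₜ Y)
    {K : Set X} {p q : X} : NS (e '' K) (e p) (e q) ↔ NS K p q := by
  refine ⟨fun h => ?_, NS.image e⟩
  have := h.image e.symm
  simpa [image_image] using this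

noncomputable def eC : ℝ × ℝ ≃ₜ ℂ := Complex.equivRealProdCLM.symm.toHomeomorph

theorem jan {A B : Set (ℝ × ℝ)} (hA : IsCompact A) (hB : IsCompact B)
    (hAB : IsPreconnected (A ∩ B))
    {p q : ℝ × ℝ} (h1 : NS A p q) (h2 : NS B p q) : NS (A ∪ B) p q := by
  rw [← NS.image_iff eC, image_union]
  apply janC (hA.image eC.continuous) (hB.image eC.continuous) _ (h1.image _) (h2.image _)
  rw [← image_inter eC.injective]
  exact hAB.image _ eC.continuous.continuousOn

theorem HasLogs.ns2 {A : Set (ℝ × ℝ)} (hA : IsCompact A) (h : HasLogs A) {p q : ℝ × ℝ}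
    (hp : p ∉ A) (hq : q ∉ A) : NS A p q := by
  rw [← NS.image_iff eC]
  apply HasLogs.ns (hA.image eC.continuous)
    (h.image hA eC.continuous.continuousOn eC.injective.injOn)
  · rwa [eC.injective.mem_set_image]
  · rwa [eC.injective.mem_set_image]

theorem jct {A B : Set (ℝ × ℝ)} (hA : IsCompact A) (hB : IsCompact B) (cA : IsPreconnected A)
    (cB : IsPreconnected B) (lA : HasLogs A) (lB : HasLogs B) {a b : ℝ × ℝ} (hab : a ≠ b)
    (hI : A ∩ B = {a, b}) : ∃ p q, p ∉ A ∪ B ∧ q ∉ A ∪ B ∧ ¬ NS (A ∪ B) p q := by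
  obtain ⟨p, q, hp, hq, h⟩ := jctC (hA.image eC.continuous) (hB.image eC.continuous)
    (cA.image _ eC.continuous.continuousOn) (cB.image _ eC.continuous.continuousOn)
    (lA.image hA eC.continuous.continuousOn eC.injective.injOn)
    (lB.image hB eC.continuous.continuousOn eC.injective.injOn)
    (eC.injective.ne hab) (by rw [← image_inter eC.injective, hI, image_pair])
  obtain ⟨p, rfl⟩ := eC.surjective p
  obtain ⟨q, rfl⟩ := eC.surjective q
  rw [← image_union, eC.injective.mem_set_image] at hp hq
  rw [← image_union, NS.image_iff] at h
  exact ⟨p, q, hp, hq, h⟩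

theorem frontier_inter {X : Type*} [TopologicalSpace X] {S D : Set X} (hS : IsPreconnected S)
    (h1 : (S ∩ D).Nonempty) (h2 : (S ∩ Dᶜ).Nonempty) : (S ∩ frontier D).Nonempty := by
  by_contra hne
  rw [not_nonempty_iff_eq_empty] at hne
  have hd : ∀ z ∈ S, z ∈ closure D → z ∈ interior D := by
    intro z hz hz'
    by_contra h
    exact (hne ▸ (⟨hz, hz', h⟩ : z ∈ S ∩ frontier D) : z ∈ (∅ : Set X))
  obtain ⟨z, hz, h3, h4⟩ := hS (interior D) (closure D)ᶜ isOpen_interior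
    isClosed_closure.isOpen_compl
    (fun z hz => by by_cases h : z ∈ closure D
                    · exact Or.inl (hd z hz h)
                    · exact Or.inr h)
    (by obtain ⟨z, hz, hz'⟩ := h1; exact ⟨z, hz, hd z hz (subset_closure hz')⟩)
    (by obtain ⟨z, hz, hz'⟩ := h2
        exact ⟨z, hz, fun h => hz' (interior_subset (hd z hz h))⟩)
  exact h4 (interior_subset_closure h3)

theorem arc_closure {f : ℝ → ℝ × ℝ} (hc : ContinuousOn f (Icc 0 1)) (hi : InjOn f (Icc 0 1))
    {B : Set (ℝ × ℝ)} (hB : IsCompact B) (lB : HasLogs B)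
    (hI : f '' Icc 0 1 ∩ B = {f 0, f 1}) {p : ℝ × ℝ} (hp : p ∉ f '' Icc 0 1 ∪ B) :
    f '' Icc 0 1 ⊆ closure (connectedComponentIn (f '' Icc 0 1 ∪ B)ᶜ p) := by
  set D := connectedComponentIn (f '' Icc 0 1 ∪ B)ᶜ p with hD
  have hAc : IsCompact (f '' Icc 0 1) := isCompact_Icc.image_of_continuousOn hc
  have hhn : ∀ s ∈ Ioo (0:ℝ) 1, f s ∈ closure D := by
    intro s hs
    by_contra hx
    have h1 : ∀ᶠ r in 𝓝 s, f r ∉ closure D ∧ r ∈ Ioo (0:ℝ) 1 := by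
      have hcs : ContinuousAt f s := hc.continuousAt (Icc_mem_nhds hs.1 hs.2)
      exact (hcs.eventually (isClosed_closure.isOpen_compl.mem_nhds hx)).and
        (Ioo_mem_nhds hs.1 hs.2)
    obtain ⟨ε, hε, hb⟩ := Metric.eventually_nhds_iff.1 h1
    set l := s - ε / 2
    set u := s + ε / 2
    have hin : ∀ r ∈ Icc l u, f r ∉ closure D ∧ r ∈ Ioo (0:ℝ) 1 := by
      intro r hr
      apply hb
      rw [Real.dist_eq, abs_lt]
      have e1 : s - ε / 2 ≤ r := hr.1
      have e2 : r ≤ s + ε / 2 := hr.2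
      constructor <;> linarith
    have hls : l < s := by simp [l, hε]
    have hsu : s < u := by simp [u, hε]
    have hl := (hin l ⟨le_refl _, by linarith⟩).2
    have hu := (hin u ⟨by linarith, le_refl _⟩).2
    have s1 : Icc 0 l ⊆ Icc (0:ℝ) 1 := Icc_subset_Icc (le_refl _) hl.2.le
    have s2 : Icc u 1 ⊆ Icc (0:ℝ) 1 := Icc_subset_Icc hu.1.le (le_refl _)
    have m0 : (0:ℝ) ∈ Icc (0:ℝ) 1 := by simp
    have m1 : (1:ℝ) ∈ Icc (0:ℝ) 1 := by simp
    have k1 : IsCompact (f '' Icc 0 l) := isCompact_Icc.image_of_continuousOn (hc.mono s1)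
    have k2 : IsCompact (f '' Icc u 1) := isCompact_Icc.image_of_continuousOn (hc.mono s2)
    have L1 : HasLogs (f '' Icc 0 l) := (HasLogs.Icc _ _).image isCompact_Icc (hc.mono s1) (hi.mono s1)
    have L2 : HasLogs (f '' Icc u 1) := (HasLogs.Icc _ _).image isCompact_Icc (hc.mono s2) (hi.mono s2)
    have hB0 : f 0 ∈ B := by
      have : f 0 ∈ f '' Icc 0 1 ∩ B := by rw [hI]; simp
      exact this.2
    have hB1 : f 1 ∈ B := by
      have : f 1 ∈ f '' Icc 0 1 ∩ B := by rw [hI]; simp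
      exact this.2
    have key : ∀ r ∈ Icc (0:ℝ) 1, f r ∈ B → r = 0 ∨ r = 1 := by
      intro r hr hrB
      have : f r ∈ f '' Icc 0 1 ∩ B := ⟨mem_image_of_mem _ hr, hrB⟩
      rw [hI] at this
      rcases this with h | h
      · exact Or.inl (hi hr m0 h)
      · exact Or.inr (hi hr m1 h)
    have i1 : B ∩ f '' Icc 0 l = {f 0} := by
      ext z
      constructor
      · rintro ⟨hz, r, hr, rfl⟩
        rcases key r (s1 hr) hz with rfl | rfl
        · rfl
        · linarith [hr.2, hl.2]
      · rintro rfl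
        exact ⟨hB0, 0, ⟨le_refl _, hl.1.le⟩, rfl⟩
    have i2 : (B ∪ f '' Icc 0 l) ∩ f '' Icc u 1 = {f 1} := by
      ext z
      constructor
      · rintro ⟨hz | ⟨r', hr', e⟩, r, hr, rfl⟩
        · rcases key r (s2 hr) hz with rfl | rfl
          · linarith [hr.1, hu.1]
          · rfl
        · have := hi (s1 hr') (s2 hr) e
          linarith [hr'.2, hr.1]
      · rintro rfl
        exact ⟨Or.inl hB1, 1, ⟨hu.2.le, le_refl _⟩, rfl⟩
    have LA : HasLogs ((B ∪ f '' Icc 0 l) ∪ f '' Icc u 1) := by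
      apply HasLogs.glue (hB.union k1).isClosed k2.isClosed _ _ L2
      · rw [i2]; exact isPreconnected_singleton
      · apply HasLogs.glue hB.isClosed k1.isClosed _ lB L1
        rw [i1]; exact isPreconnected_singleton
    have hsub : (B ∪ f '' Icc 0 l) ∪ f '' Icc u 1 ⊆ f '' Icc 0 1 ∪ B := by
      rintro z ((h | h) | h)
      · exact Or.inr h
      · exact Or.inl (image_mono s1 h)
      · exact Or.inl (image_mono s2 h)
    have hsI : s ∈ Icc (0:ℝ) 1 := Ioo_subset_Icc_self hs
    have hsx : f s ∉ (B ∪ f '' Icc 0 l) ∪ f '' Icc u 1 := by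
      rintro ((h | ⟨r, hr, e⟩) | ⟨r, hr, e⟩)
      · rcases key s hsI h with rfl | rfl
        · exact lt_irrefl _ hs.1
        · exact lt_irrefl _ hs.2
      · have := hi (s1 hr) hsI e
        linarith [hr.2]
      · have := hi (s2 hr) hsI e
        linarith [hr.1]
    obtain ⟨S, c1, c2, c3, c4⟩ := LA.ns2 ((hB.union k1).union k2) (fun h => hp (hsub h)) hsx
    have hfr : frontier D ⊆ f '' Icc 0 1 ∪ B := frontier_comp (hAc.union hB).isClosed
    obtain ⟨z, hzS, hzF⟩ := frontier_inter c1 (D := D)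
      ⟨p, c2, mem_connectedComponentIn hp⟩ ⟨f s, c3, fun h => hx (subset_closure h)⟩
    apply c4 hzS
    rcases hfr hzF with ⟨r, hr, rfl⟩ | h
    · rcases le_or_gt r l with h | h
      · exact Or.inl (Or.inr ⟨r, ⟨hr.1, h⟩, rfl⟩)
      · rcases le_or_gt u r with h' | h'
        · exact Or.inr ⟨r, ⟨h', hr.2⟩, rfl⟩
        · exact absurd (frontier_subset_closure hzF) (hin r ⟨h.le, h'.le⟩).1
    · exact Or.inl (Or.inl h)
  have : closure (Ioo (0:ℝ) 1) = Icc 0 1 := closure_Ioo (by norm_num)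
  rw [← this] at hc ⊢
  have h3 := (hc.image_closure)
  refine h3.trans (closure_minimal ?_ isClosed_closure)
  rintro _ ⟨s, hs, rfl⟩
  exact hhn s hs

open Set Topology

section G1
open SimpleGraph
variable {V : Type*} {G : SimpleGraph V}

theorem rtg_symm {α : Type*} {r : α → α → Prop} (hr : ∀ x y, r x y → r y x) {a b : α}
    (h : Relation.ReflTransGen r a b) : Relation.ReflTransGen r b a := by
  induction h with
  | refl => exact Relation.ReflTransGen.refl
  | tail _ h ih => exact Relation.ReflTransGen.head (hr _ _ h) ih

theorem rtg_mono {α : Type*} {r r' : α → α → Prop} (hr : ∀ x y, r x y → r' x y) {a b : α}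
    (h : Relation.ReflTransGen r a b) : Relation.ReflTransGen r' a b := by
  induction h with
  | refl => exact Relation.ReflTransGen.refl
  | tail _ h ih => exact Relation.ReflTransGen.tail ih (hr _ _ h)

def IsCyc (S : G.Subgraph) : Prop := ∃ u, ∃ c : G.Walk u u, c.IsCycle ∧ c.toSubgraph = S

def SConn (S : G.Subgraph) : Prop :=
  ∀ u ∈ S.verts, ∀ v ∈ S.verts, Relation.ReflTransGen S.Adj u v

theorem walk_sconn {u v : V} (p : G.Walk u v) : SConn p.toSubgraph := by
  have key : ∀ w ∈ p.toSubgraph.verts, Relation.ReflTransGen p.toSubgraph.Adj u w := by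
    induction p with
    | nil =>
      intro w hw
      simp at hw
      subst hw
      exact Relation.ReflTransGen.refl
    | @cons u v w h p ih =>
      intro z hz
      rw [Walk.mem_verts_toSubgraph, Walk.support_cons, List.mem_cons] at hz
      rcases hz with rfl | hz
      · exact Relation.ReflTransGen.refl
      · refine Relation.ReflTransGen.head (b := v) ?_ ?_
        · simp [Walk.toSubgraph]
        · have := ih z (by rwa [Walk.mem_verts_toSubgraph])
          refine rtg_mono ?_ this
          intro a b hab
          simp only [Walk.toSubgraph, Subgraph.sup_adj]
          exact Or.inr hab
  intro a ha b hb
  refine Relation.ReflTransGen.trans ?_ (key b hb)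
  exact rtg_symm (fun x y h => h.symm) (key a ha)

theorem cyc_sconn {S : G.Subgraph} (h : IsCyc S) : SConn S := by
  obtain ⟨u, c, -, rfl⟩ := h
  exact walk_sconn c

theorem cyc_start {S : G.Subgraph} (h : IsCyc S) {a : V} (ha : a ∈ S.verts) :
    ∃ c : G.Walk a a, c.IsCycle ∧ c.toSubgraph = S := by
  classical
  obtain ⟨u, c, hc, rfl⟩ := h
  rw [Walk.mem_verts_toSubgraph] at ha
  exact ⟨c.rotate a ha, hc.rotate ha, Walk.toSubgraph_rotate c ha⟩

theorem cyc_nbr {S : G.Subgraph} (h : IsCyc S) {a : V} (ha : a ∈ S.verts) :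
    ∃ b d, b ≠ d ∧ S.Adj a b ∧ S.Adj a d := by
  obtain ⟨c, hc, rfl⟩ := cyc_start h ha
  have h1 := hc.neighborSet_toSubgraph_endpoint
  refine ⟨c.snd, c.penultimate, hc.snd_ne_penultimate, ?_, ?_⟩
  · have : c.snd ∈ c.toSubgraph.neighborSet a := by rw [h1]; simp
    exact this
  · have : c.penultimate ∈ c.toSubgraph.neighborSet a := by rw [h1]; simp
    exact this

theorem cyc_nonempty {S : G.Subgraph} (h : IsCyc S) : ∃ a, a ∈ S.verts := by
  obtain ⟨u, c, hc, rfl⟩ := h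
  exact ⟨u, by simp⟩

theorem cyc_three {S : G.Subgraph} (h : IsCyc S) (a b : V) : ∃ d ∈ S.verts, d ≠ a ∧ d ≠ b := by
  obtain ⟨u, hu⟩ := cyc_nonempty h
  obtain ⟨x, y, hxy, h1, h2⟩ := cyc_nbr h hu
  have := h1.ne
  have := h2.ne
  have := h1.snd_mem
  have := h2.snd_mem
  by_cases e1 : u = a
  · by_cases e2 : x = b
    · exact ⟨y, by assumption, by grind, by grind⟩
    · exact ⟨x, by assumption, by grind, by grind⟩
  · by_cases e2 : u = b
    · by_cases e3 : x = a
      · exact ⟨y, by assumption, by grind, by grind⟩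
      · exact ⟨x, by assumption, by grind, by grind⟩
    · exact ⟨u, hu, e1, e2⟩

theorem cyc_decomp {S : G.Subgraph} (h : IsCyc S) {a b : V} (hab : S.Adj a b) :
    ∃ p : G.Walk b a, p.IsPath ∧ s(a, b) ∉ p.edges ∧
      S = G.subgraphOfAdj hab.adj_sub ⊔ p.toSubgraph := by
  have main : ∀ c : G.Walk a a, c.IsCycle → c.toSubgraph = S → c.snd = b → 
     ∃ p : G.Walk b a, p.IsPath ∧ s(a, b) ∉ p.edges ∧
      S = G.subgraphOfAdj hab.adj_sub ⊔ p.toSubgraph := by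
    intro c hc hS hb
    cases c with
    | nil => simp at hc
    | cons h p =>
      simp at hb
      subst hb
      rw [Walk.cons_isCycle_iff] at hc
      exact ⟨p, hc.1, hc.2, hS.symm⟩
  obtain ⟨c, hc, hS⟩ := cyc_start h hab.fst_mem
  have h1 := hc.neighborSet_toSubgraph_endpoint
  have h2 : b ∈ c.toSubgraph.neighborSet a := by rw [hS]; exact hab
  rw [h1] at h2
  rcases h2 with h2 | h2
  · exact main c hc hS h2.symm
  · exact main c.reverse hc.reverse (by rw [Walk.toSubgraph_reverse, hS])
      (by rw [Walk.snd_reverse]; exact h2.symm)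

theorem cyc_split {S : G.Subgraph} (h : IsCyc S) {x y : V} (hx : x ∈ S.verts) (hy : y ∈ S.verts)
    (hxy : x ≠ y) : ∃ P Q : G.Walk x y, P.IsPath ∧ Q.IsPath ∧
      P.toSubgraph ⊔ Q.toSubgraph = S ∧ (∀ z ∈ P.support, z ∈ Q.support → z = x ∨ z = y) ∧
      ∀ e ∈ P.edges, e ∉ Q.edges := by
  classical
  obtain ⟨c, hc, rfl⟩ := cyc_start h hx
  rw [Walk.mem_verts_toSubgraph] at hy
  have hsp := c.take_spec hy
  set P := c.takeUntil y hy with hP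
  set Q := c.dropUntil y hy with hQ
  have hc' : (P.append Q).IsCycle := by rw [hsp]; exact hc
  have nP : ¬ P.Nil := fun h => hxy h.eq
  have nQ : ¬ Q.Nil := fun h => hxy h.eq.symm
  have pP := hc'.isPath_of_append_left nQ
  have pQ := hc'.isPath_of_append_right nP
  refine ⟨P, Q.reverse, pP, pQ.reverse, ?_, ?_, ?_⟩
  · rw [Walk.toSubgraph_reverse, ← Walk.toSubgraph_append, hsp]
  · intro z hz hz'
    rw [Walk.support_reverse, List.mem_reverse] at hz'
    have hn := hc'.support_nodup
    rw [Walk.tail_support_append] at hn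
    have hd := List.disjoint_of_nodup_append hn
    by_contra hcon
    push Not at hcon
    rw [Walk.mem_support_iff] at hz hz'
    rcases hz with hz | hz
    · exact hcon.1 hz
    rcases hz' with hz' | hz'
    · exact hcon.2 hz'
    exact hd hz hz'
  · intro e he he'
    rw [Walk.edges_reverse, List.mem_reverse] at he'
    have hn := hc'.edges_nodup
    rw [Walk.edges_append] at hn
    exact List.disjoint_of_nodup_append hn he he'

theorem cyc_glue {x y : V} (hxy : x ≠ y) {P Q : G.Walk x y} (hP : P.IsPath) (hQ : Q.IsPath)
    (hd : ∀ z ∈ P.support, z ∈ Q.support → z = x ∨ z = y) (he : ∀ e ∈ P.edges, e ∉ Q.edges) :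
    IsCyc (P.toSubgraph ⊔ Q.toSubgraph) := by
  have nP : ¬ P.Nil := fun h => hxy h.eq
  have nQ : ¬ Q.Nil := fun h => hxy h.eq
  refine ⟨x, P.append Q.reverse, ?_, ?_⟩
  · apply hP.isCycle_append hQ.reverse
    · intro z hz hz'
      have h1 : z ∈ P.support := List.mem_of_mem_tail hz
      have h2 : z ∈ Q.reverse.support := List.mem_of_mem_tail hz'
      rw [Walk.support_reverse, List.mem_reverse] at h2
      have n1 := hP.support_nodup
      have n2 := hQ.reverse.support_nodup
      rw [← Walk.cons_tail_support, List.nodup_cons] at n1 n2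
      rcases hd z h1 h2 with rfl | rfl
      · exact n1.1 hz
      · exact n2.1 hz'
    · by_contra hcon
      push Not at hcon
      rw [Walk.length_reverse] at hcon
      cases P with
      | nil => exact hxy rfl
      | cons h p =>
        cases Q with
        | nil => exact hxy rfl
        | cons h' q =>
          simp at hcon
          have e1 := hcon.1.eq
          have e2 := hcon.2.eq
          refine he s(x, y) ?_ ?_
          · rw [Walk.edges_cons]; simp [e1, e2]
          · rw [Walk.edges_cons]; simp [e1, e2]
  · rw [Walk.toSubgraph_append, Walk.toSubgraph_reverse]

end G1

open Set Topology

section G2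
open SimpleGraph
variable {V : Type*} {G : SimpleGraph V}

/-- adjacency avoiding two vertices -/
def AvAdj (G : SimpleGraph V) (a b : V) (x y : V) : Prop :=
  G.Adj x y ∧ (x ≠ a ∧ x ≠ b) ∧ (y ≠ a ∧ y ≠ b)

def Tri (G : SimpleGraph V) : Prop :=
  (∀ a b u v, u ≠ a → u ≠ b → v ≠ a → v ≠ b → Relation.ReflTransGen (AvAdj G a b) u v) ∧
  ∀ a b : V, ∃ c, c ≠ a ∧ c ≠ b

theorem rtg_of_reach {s : Set V} {u v : s} (h : (G.induce s).Reachable u v) :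
    Relation.ReflTransGen (fun x y => G.Adj x y ∧ x ∈ s ∧ y ∈ s) (u : V) v := by
  obtain ⟨p⟩ := h
  induction p with
  | nil => exact Relation.ReflTransGen.refl
  | @cons u v w h p ih => exact Relation.ReflTransGen.head ⟨h, u.2, v.2⟩ ih

theorem Triconnected.tri [Finite V] (h : Triconnected G) : Tri G := by
  obtain ⟨⟨hc, -, hcut⟩, h3, h2⟩ := h
  constructor
  · intro a b u v hua hub hva hvb
    by_cases hab : a = b
    · subst hab
      have h1 := hcut a
      unfold IsCutVertex at h1
      have hsub : Subsingleton G.ConnectedComponent := hc.preconnected.subsingleton_connectedComponent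
      have hle : Nat.card G.ConnectedComponent ≤ 1 := Finite.card_le_one_iff_subsingleton.2 hsub
      have hle' : Nat.card ((G.induce {v : V | v ≠ a}).ConnectedComponent) ≤ 1 := by omega
      have hs' := Finite.card_le_one_iff_subsingleton.1 hle'
      have hr : (G.induce {v : V | v ≠ a}).Reachable ⟨u, hua⟩ ⟨v, hva⟩ :=
        ConnectedComponent.exact (hs'.elim _ _)
      refine rtg_mono ?_ (rtg_of_reach hr)
      rintro x y ⟨h1, h2, h3⟩
      exact ⟨h1, ⟨h2, h2⟩, ⟨h3, h3⟩⟩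
    · have hr := (h2 a b hab).preconnected ⟨u, hua, hub⟩ ⟨v, hva, hvb⟩
      exact rtg_of_reach hr
  · intro a b
    by_contra hcon
    push Not at hcon
    have : (Set.univ : Set V) ⊆ {a, b} := fun c _ => by
      by_cases h : c = a
      · exact Or.inl h
      · exact Or.inr (hcon c h)
    have h4 := Set.ncard_le_ncard this (Set.toFinite _)
    rw [Set.ncard_univ] at h4
    have := Set.ncard_insert_le a {b}
    rw [Set.ncard_singleton] at this
    omega

theorem Tri.conn (h : Tri G) (u v : V) : Relation.ReflTransGen G.Adj u v := by
  obtain ⟨c, h1, h2⟩ := h.2 u v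
  exact rtg_mono (fun _ _ h => h.1) (h.1 c c u v h1.symm h1.symm h2.symm h2.symm)

theorem Tri.nbr (h : Tri G) (v a : V) (hva : v ≠ a) : ∃ x, G.Adj v x ∧ x ≠ a := by
  obtain ⟨c, h1, h2⟩ := h.2 v a
  rcases (h.1 a a v c hva hva h2 h2).cases_head with rfl | ⟨d, hd, -⟩
  · exact absurd rfl h1
  · exact ⟨d, hd.1, hd.2.2.1⟩

theorem walk_of_rtg {r : V → V → Prop} (hs : ∀ a b, r a b → r b a) (hr : ∀ a b, r a b → G.Adj a b)
    {u v : V} (h : Relation.ReflTransGen r u v) :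
    ∃ p : G.Walk u v, p.IsPath ∧ ∀ a b, s(a, b) ∈ p.edges → r a b := by
  classical
  have : ∃ p : G.Walk u v, ∀ a b, s(a, b) ∈ p.edges → r a b := by
    induction h with
    | refl => exact ⟨Walk.nil, by simp⟩
    | @tail b c _ h ih =>
      obtain ⟨p, hp⟩ := ih
      refine ⟨p.concat (hr _ _ h), ?_⟩
      intro x y hxy
      rw [Walk.edges_concat, List.concat_eq_append, List.mem_append, List.mem_singleton] at hxy
      rcases hxy with hxy | hxy
      · exact hp x y hxy
      · rcases Sym2.eq_iff.1 hxy with ⟨rfl, rfl⟩ | ⟨rfl, rfl⟩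
        · exact h
        · exact hs _ _ h
  obtain ⟨p, hp⟩ := this
  exact ⟨p.bypass, p.bypass_isPath, fun a b hab => hp a b (p.edges_bypass_subset_edges hab)⟩

theorem support_edge {u v : V} (p : G.Walk u v) (huv : u ≠ v) {z : V} (hz : z ∈ p.support) :
    ∃ w, s(z, w) ∈ p.edges := by
  have hn : ¬ p.Nil := fun h => huv h.eq
  obtain ⟨e, he, hze⟩ := (Walk.mem_support_iff_exists_mem_edges_of_not_nil hn).1 hz
  induction e with
  | h a b =>
    rcases Sym2.mem_iff.1 hze with rfl | rfl
    · exact ⟨b, he⟩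
    · exact ⟨a, by rwa [Sym2.eq_swap]⟩

theorem Tri.cyc (h : Tri G) (v : V) : ∃ C : G.Subgraph, IsCyc C ∧ v ∈ C.verts := by
  obtain ⟨c, hc, -⟩ := h.2 v v
  obtain ⟨x, hx, -⟩ := h.nbr v c hc.symm
  obtain ⟨y, hy, hyx⟩ := h.nbr v x hx.ne
  obtain ⟨p, hp, hpe⟩ := walk_of_rtg (G := G) (r := AvAdj G v v)
    (fun a b h => ⟨h.1.symm, h.2.2, h.2.1⟩) (fun _ _ h => h.1)
    (h.1 v v x y hx.ne' hx.ne' hy.ne' hy.ne')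
  have hvp : v ∉ p.support := fun hv => by
    obtain ⟨w, hw⟩ := support_edge p hyx.symm hv
    exact (hpe _ _ hw).2.1.1 rfl
  refine ⟨_, cyc_glue hy.ne (P := Walk.cons hx p) (Q := Walk.cons hy Walk.nil) ?_ ?_ ?_ ?_, ?_⟩
  · rw [Walk.cons_isPath_iff]; exact ⟨hp, hvp⟩
  · rw [Walk.cons_isPath_iff]; exact ⟨by simp, by simpa using hy.ne⟩
  · intro z _ hz
    simpa using hz
  · intro e he he'
    simp only [Walk.edges_cons, Walk.edges_nil, List.mem_singleton] at he'
    subst he'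
    rw [Walk.edges_cons, List.mem_cons] at he
    rcases he with he | he
    · rw [Sym2.eq_iff] at he
      rcases he with ⟨_, h⟩ | ⟨h1, h2⟩
      · exact hyx h
      · exact hx.ne h1
    · exact (hpe _ _ he).2.1.1 rfl
  · simp

end G2

open Set Topology

namespace PlaneEmbedding
open SimpleGraph
variable {V : Type*} {G : SimpleGraph V} (Φ : PlaneEmbedding G)

/-- the arc of an edge, empty for non-edges -/
def ar (e : Sym2 V) : Set (ℝ × ℝ) := {z | ∃ h : e ∈ G.edgeSet, z ∈ Φ.arc ⟨e, h⟩}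

def dr (S : G.Subgraph) : Set (ℝ × ℝ) := {z | (∃ v ∈ S.verts, Φ.vmap v = z) ∨
  ∃ e ∈ S.edgeSet, z ∈ Φ.ar e}

variable {Φ}

theorem ar_param {u v : V} (h : G.Adj u v) : ∃ f : ℝ → ℝ × ℝ, ContinuousOn f (Icc 0 1) ∧
    InjOn f (Icc 0 1) ∧ f '' Icc 0 1 = Φ.ar s(u, v) ∧ f 0 = Φ.vmap u ∧ f 1 = Φ.vmap v := by
  obtain ⟨f, hf, hi, hr, a, b, hab, h0, h1⟩ := Φ.arc_path ⟨s(u, v), h⟩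
  have hA : Φ.ar s(u, v) = Set.range f := by
    rw [hr]
    ext z
    exact ⟨fun ⟨_, h⟩ => h, fun h' => ⟨h, h'⟩⟩
  have key : ∀ g : unitInterval → ℝ × ℝ, Continuous g → Function.Injective g →
      Set.range g = Φ.ar s(u, v) → g 0 = Φ.vmap u → g 1 = Φ.vmap v → 
      ∃ f : ℝ → ℝ × ℝ, ContinuousOn f (Icc 0 1) ∧
      InjOn f (Icc 0 1) ∧ f '' Icc 0 1 = Φ.ar s(u, v) ∧ f 0 = Φ.vmap u ∧ f 1 = Φ.vmap v := by
    intro g hg hgi hgr g0 g1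
    refine ⟨Set.IccExtend zero_le_one g, hg.Icc_extend'.continuousOn, ?_, ?_, ?_, ?_⟩
    · intro x hx y hy hxy
      rw [Set.IccExtend_of_mem _ _ hx, Set.IccExtend_of_mem _ _ hy] at hxy
      simpa using hgi hxy
    · rw [← hgr]
      ext z
      constructor
      · rintro ⟨x, hx, rfl⟩
        exact ⟨⟨x, hx⟩, (Set.IccExtend_of_mem _ _ hx).symm⟩
      · rintro ⟨x, rfl⟩
        exact ⟨x, x.2, Set.IccExtend_of_mem _ _ x.2⟩
    · rw [Set.IccExtend_left, ← g0]; rfl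
    · rw [Set.IccExtend_right, ← g1]; rfl
  rcases Sym2.eq_iff.1 hab with ⟨rfl, rfl⟩ | ⟨rfl, rfl⟩
  · exact key f hf hi hA.symm h0 h1
  · refine key (f ∘ unitInterval.symm) (hf.comp unitInterval.continuous_symm)
      (hi.comp unitInterval.symm_bijective.injective) ?_ ?_ ?_
    · rw [unitInterval.symm_bijective.surjective.range_comp, hA]
    · simp [h1]
    · simp [h0]

theorem ar_inter {e e' : Sym2 V} (hne : e ≠ e') {z : ℝ × ℝ} (h : z ∈ Φ.ar e) (h' : z ∈ Φ.ar e') :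
    ∃ x, x ∈ e ∧ x ∈ e' ∧ Φ.vmap x = z := by
  obtain ⟨h1, h2⟩ := h
  obtain ⟨h1', h2'⟩ := h'
  obtain ⟨x, hx, hz⟩ := Φ.arc_inter ⟨e, h1⟩ ⟨e', h1'⟩ (by simpa using hne) ⟨h2, h2'⟩
  exact ⟨x, hx.1, hx.2, hz⟩

theorem mem_of_vmap_ar {e : Sym2 V} {x : V} (h : Φ.vmap x ∈ Φ.ar e) : x ∈ e :=
  Φ.vmap_mem_arc _ _ h.2

theorem left_ar {u v : V} (h : G.Adj u v) : Φ.vmap u ∈ Φ.ar s(u, v) := by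
  obtain ⟨f, -, -, h3, h4, -⟩ := Φ.ar_param h
  rw [← h3, ← h4]
  exact ⟨0, by simp, rfl⟩

theorem right_ar {u v : V} (h : G.Adj u v) : Φ.vmap v ∈ Φ.ar s(u, v) := by
  rw [Sym2.eq_swap]; exact left_ar h.symm

theorem vmap_ar {e : Sym2 V} (h : e ∈ G.edgeSet) {x : V} (hx : x ∈ e) : Φ.vmap x ∈ Φ.ar e := by
  induction e with
  | h u v =>
    rcases Sym2.mem_iff.1 hx with rfl | rfl
    · exact left_ar h
    · exact right_ar h

theorem vmap_dr {S : G.Subgraph} {v : V} : Φ.vmap v ∈ Φ.dr S ↔ v ∈ S.verts := by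
  constructor
  · rintro (⟨w, hw, h⟩ | ⟨e, he, h⟩)
    · rwa [← Φ.vmap_inj h]
    · exact S.mem_verts_of_mem_edge he (mem_of_vmap_ar h)
  · exact fun h => Or.inl ⟨v, h, rfl⟩

theorem ar_dr {S : G.Subgraph} {e : Sym2 V} (he : e ∈ S.edgeSet) : Φ.ar e ⊆ Φ.dr S :=
  fun _ hz => Or.inr ⟨e, he, hz⟩

theorem nonvert_dr {S : G.Subgraph} {e : Sym2 V} {z : ℝ × ℝ} (hz : z ∈ Φ.ar e)
    (hv : ∀ x, Φ.vmap x ≠ z) (h : z ∈ Φ.dr S) : e ∈ S.edgeSet := by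
  rcases h with ⟨w, _, h⟩ | ⟨e', he', h⟩
  · exact absurd h (hv w)
  · by_cases hee : e = e'
    · rwa [hee]
    · obtain ⟨x, _, _, hx⟩ := ar_inter hee hz h
      exact absurd hx (hv x)

theorem dr_mono {S T : G.Subgraph} (h : S ≤ T) : Φ.dr S ⊆ Φ.dr T := by
  rintro z (⟨v, hv, hz⟩ | ⟨e, he, hz⟩)
  · exact Or.inl ⟨v, h.1 hv, hz⟩
  · exact Or.inr ⟨e, Subgraph.edgeSet_mono h he, hz⟩

theorem dr_sup (S T : G.Subgraph) : Φ.dr (S ⊔ T) = Φ.dr S ∪ Φ.dr T := by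
  apply subset_antisymm
  · rintro z (⟨v, hv, hz⟩ | ⟨e, he, hz⟩)
    · rcases hv with hv | hv
      · exact Or.inl (Or.inl ⟨v, hv, hz⟩)
      · exact Or.inr (Or.inl ⟨v, hv, hz⟩)
    · rw [Subgraph.edgeSet_sup] at he
      rcases he with hv | hv
      · exact Or.inl (Or.inr ⟨e, hv, hz⟩)
      · exact Or.inr (Or.inr ⟨e, hv, hz⟩)
  · exact union_subset (dr_mono le_sup_left) (dr_mono le_sup_right)

theorem dr_inf (S T : G.Subgraph) : Φ.dr (S ⊓ T) = Φ.dr S ∩ Φ.dr T := by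
  apply subset_antisymm
  · exact subset_inter (dr_mono inf_le_left) (dr_mono inf_le_right)
  · rintro z ⟨h1, h2⟩
    by_cases hz : ∃ x, Φ.vmap x = z
    · obtain ⟨x, rfl⟩ := hz
      rw [vmap_dr] at *
      exact ⟨h1, h2⟩
    · push Not at hz
      rcases h1 with ⟨w, _, h⟩ | ⟨e, he, h⟩
      · exact absurd h (hz w)
      · refine Or.inr ⟨e, ?_, h⟩
        rw [Subgraph.edgeSet_inf]
        exact ⟨he, nonvert_dr h hz h2⟩

theorem ar_compact (e : Sym2 V) : IsCompact (Φ.ar e) := by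
  by_cases h : e ∈ G.edgeSet
  · induction e with
    | h u v =>
      obtain ⟨f, h1, h2, h3, -⟩ := Φ.ar_param (u := u) (v := v) h
      rw [← h3]
      exact isCompact_Icc.image_of_continuousOn h1
  · have : Φ.ar e = ∅ := by
      ext z
      exact ⟨fun ⟨h', _⟩ => h h', fun h => h.elim⟩
    rw [this]; exact isCompact_empty

theorem ar_logs {u v : V} (h : G.Adj u v) : HasLogs (Φ.ar s(u, v)) := by
  obtain ⟨f, h1, h2, h3, -⟩ := Φ.ar_param h
  rw [← h3]
  exact (HasLogs.Icc _ _).image isCompact_Icc h1 h2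

theorem ar_conn {u v : V} (h : G.Adj u v) : IsPreconnected (Φ.ar s(u, v)) := by
  obtain ⟨f, h1, h2, h3, -⟩ := Φ.ar_param h
  rw [← h3]
  exact isPreconnected_Icc.image _ h1

theorem ar_half {u v : V} (h : G.Adj u v) : IsPreconnected (Φ.ar s(u, v) \ {Φ.vmap v}) := by
  obtain ⟨f, h1, h2, h3, -, h4⟩ := Φ.ar_param h
  have : Φ.ar s(u, v) \ {Φ.vmap v} = f '' Ico 0 1 := by
    rw [← h3, ← h4]
    ext z
    constructor
    · rintro ⟨⟨x, hx, rfl⟩, hz⟩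
      refine ⟨x, ⟨hx.1, lt_of_le_of_ne hx.2 ?_⟩, rfl⟩
      rintro rfl
      exact hz rfl
    · rintro ⟨x, hx, rfl⟩
      refine ⟨⟨x, ⟨hx.1, hx.2.le⟩, rfl⟩, fun e => ?_⟩
      have := h2 ⟨hx.1, hx.2.le⟩ (by simp) e
      exact hx.2.ne this
  rw [this]
  exact isPreconnected_Ico.image _ (h1.mono Ico_subset_Icc_self)

theorem ar_open {u v : V} (h : G.Adj u v) :
    IsPreconnected (Φ.ar s(u, v) \ {Φ.vmap u, Φ.vmap v}) := by
  obtain ⟨f, h1, h2, h3, h0, h4⟩ := Φ.ar_param h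
  have : Φ.ar s(u, v) \ {Φ.vmap u, Φ.vmap v} = f '' Ioo 0 1 := by
    rw [← h3, ← h4, ← h0]
    ext z
    constructor
    · rintro ⟨⟨x, hx, rfl⟩, hz⟩
      refine ⟨x, ⟨lt_of_le_of_ne hx.1 ?_, lt_of_le_of_ne hx.2 ?_⟩, rfl⟩
      · rintro rfl
        exact hz (Or.inl rfl)
      · rintro rfl
        exact hz (Or.inr rfl)
    · rintro ⟨x, hx, rfl⟩
      refine ⟨⟨x, ⟨hx.1.le, hx.2.le⟩, rfl⟩, fun e => ?_⟩
      rcases e with e | e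
      · have := h2 ⟨hx.1.le, hx.2.le⟩ (by simp) e
        exact hx.1.ne' this
      · have := h2 ⟨hx.1.le, hx.2.le⟩ (by simp) e
        exact hx.2.ne this
  rw [this]
  exact isPreconnected_Ioo.image _ (h1.mono Ioo_subset_Icc_self)

theorem ar_mid {u v : V} (h : G.Adj u v) : ∃ m ∈ Φ.ar s(u, v), ∀ x, Φ.vmap x ≠ m := by
  obtain ⟨f, h1, h2, h3, h0, h4⟩ := Φ.ar_param h
  have hm : (1/2 : ℝ) ∈ Icc (0:ℝ) 1 := by constructor <;> norm_num
  have hmem : f (1/2) ∈ Φ.ar s(u, v) := by rw [← h3]; exact ⟨_, hm, rfl⟩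
  refine ⟨f (1/2), hmem, fun x hx => ?_⟩
  have := mem_of_vmap_ar (hx ▸ hmem)
  rcases Sym2.mem_iff.1 this with rfl | rfl
  · rw [← h0] at hx
    have := h2 (by simp) hm hx
    norm_num at this
  · rw [← h4] at hx
    have := h2 (by simp) hm hx
    norm_num at this

theorem dr_compact [Finite V] (S : G.Subgraph) : IsCompact (Φ.dr S) := by
  have : Φ.dr S = Φ.vmap '' S.verts ∪ ⋃ e ∈ S.edgeSet, Φ.ar e := by
    ext z
    simp only [dr, mem_ofPred_eq, mem_union, mem_image, mem_iUnion, exists_prop]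
  rw [this]
  refine ((Set.toFinite _).image _).isCompact.union ?_
  exact (Set.toFinite S.edgeSet).isCompact_biUnion (fun e _ => ar_compact e)

theorem NS.refl' {X : Type*} [TopologicalSpace X] {K : Set X} {p : X} (h : p ∉ K) : NS K p p :=
  ⟨{p}, isPreconnected_singleton, rfl, rfl, by simpa using h⟩

theorem ns_of {X : Type*} [TopologicalSpace X] {S K : Set X} (h : IsPreconnected S)
    (hd : ∀ z ∈ S, z ∉ K) {p q : X} (hp : p ∈ S) (hq : q ∈ S) : NS K p q :=
  ⟨S, h, hp, hq, hd⟩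

theorem precon_of_ns {X : Type*} [TopologicalSpace X] {S : Set X}
    (h : ∀ p ∈ S, ∀ q ∈ S, NS Sᶜ p q) : IsPreconnected S := by
  apply isPreconnected_of_forall_pair
  intro x hx y hy
  obtain ⟨t, h1, h2, h3, h4⟩ := h x hx y hy
  rw [compl_compl] at h4
  exact ⟨t, h4, h2, h3, h1⟩

theorem ns_chain {r : V → V → Prop} {K : Set (ℝ × ℝ)}
    (hr : ∀ u v, r u v → G.Adj u v ∧ ∀ z ∈ Φ.ar s(u, v), z ∉ K) {u v : V}
    (hu : Φ.vmap u ∉ K) (h : Relation.ReflTransGen r u v) : NS K (Φ.vmap u) (Φ.vmap v) := by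
  induction h with
  | refl => exact NS.refl' hu
  | tail _ h ih =>
    obtain ⟨h1, h2⟩ := hr _ _ h
    exact ih.trans (ns_of (ar_conn h1) h2 (left_ar h1) (right_ar h1))

theorem dr_conn {S : G.Subgraph} (h : SConn S) : IsPreconnected (Φ.dr S) := by
  have key : ∀ z ∈ Φ.dr S, ∃ v ∈ S.verts, NS (Φ.dr S)ᶜ (Φ.vmap v) z := by
    rintro z (⟨v, hv, rfl⟩ | ⟨e, he, hz⟩)
    · exact ⟨v, hv, NS.refl' (by rw [notMem_compl_iff, vmap_dr]; exact hv)⟩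
    · induction e with
      | h u v =>
        refine ⟨u, Subgraph.edge_vert _ he, ns_of (ar_conn (S.adj_sub he)) ?_ 
          (left_ar (S.adj_sub he)) hz⟩
        intro w hw
        rw [notMem_compl_iff]
        exact ar_dr he hw
  apply precon_of_ns
  intro p hp q hq
  obtain ⟨u, hu, h1⟩ := key p hp
  obtain ⟨v, hv, h2⟩ := key q hq
  refine h1.symm.trans (NS.trans ?_ h2)
  refine ns_chain (r := S.Adj) ?_ ?_ (h u hu v hv)
  · intro a b hab
    refine ⟨S.adj_sub hab, fun z hz => ?_⟩
    rw [notMem_compl_iff]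
    exact ar_dr hab hz
  · rw [notMem_compl_iff, vmap_dr]; exact hu

theorem dr_edge {u v : V} (h : G.Adj u v) : Φ.dr (G.subgraphOfAdj h) = Φ.ar s(u, v) := by
  apply subset_antisymm
  · rintro z (⟨w, hw, rfl⟩ | ⟨e, he, hz⟩)
    · apply vmap_ar h
      simpa using hw
    · rw [edgeSet_subgraphOfAdj] at he
      rwa [mem_singleton_iff.1 he] at hz
  · apply ar_dr
    rw [edgeSet_subgraphOfAdj]; rfl

theorem path_logs [Finite V] {u v : V} (p : G.Walk u v) (hp : p.IsPath) :
    HasLogs (Φ.dr p.toSubgraph) := by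
  induction p with
  | nil =>
    rename_i u
    have : Φ.dr (Walk.nil : G.Walk u u).toSubgraph = {Φ.vmap u} := by
      ext z
      simp [dr, eq_comm]
    rw [this]; exact HasLogs.singleton _
  | @cons u v w h p ih =>
    rw [Walk.cons_isPath_iff] at hp
    have e : (Walk.cons h p).toSubgraph = G.subgraphOfAdj h ⊔ p.toSubgraph := rfl
    rw [e, dr_sup]
    refine HasLogs.glue (dr_compact _).isClosed (dr_compact _).isClosed ?_ ?_ (ih hp.1)
    · have : Φ.dr (G.subgraphOfAdj h) ∩ Φ.dr p.toSubgraph = {Φ.vmap v} := by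
        rw [← dr_inf]
        ext z
        constructor
        · rintro (⟨x, hx, rfl⟩ | ⟨e, he, hz⟩)
          · have h1 : x = u ∨ x = v := by simpa using hx.1
            have h2 : x ∈ p.support := by simpa using hx.2
            rcases h1 with rfl | rfl
            · exact absurd h2 hp.2
            · rfl
          · rw [Subgraph.edgeSet_inf, edgeSet_subgraphOfAdj] at he
            have h1 := mem_singleton_iff.1 he.1
            subst h1
            have h2 : u ∈ p.toSubgraph.verts := Subgraph.edge_vert _ he.2
            rw [Walk.mem_verts_toSubgraph] at h2
            exact absurd h2 hp.2
        · rintro rfl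
          rw [vmap_dr]
          constructor
          · simp
          · simp
      rw [this]; exact isPreconnected_singleton
    · rw [dr_edge]; exact ar_logs h

theorem cyc_inter [Finite V] {a b : V} (h : G.Adj a b) (p : G.Walk b a)
    (he : s(a, b) ∉ p.edges) : Φ.ar s(a, b) ∩ Φ.dr p.toSubgraph = {Φ.vmap a, Φ.vmap b} := by
  rw [← dr_edge h, ← dr_inf]
  ext z
  constructor
  · rintro (⟨x, hx, rfl⟩ | ⟨e, he', hz⟩)
    · have h1 : x = a ∨ x = b := by simpa using hx.1
      rcases h1 with rfl | rfl <;> simp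
    · rw [Subgraph.edgeSet_inf, edgeSet_subgraphOfAdj] at he'
      have h1 := mem_singleton_iff.1 he'.1
      subst h1
      exact absurd (by simpa using he'.2) he
  · rintro (rfl | rfl) <;> rw [vmap_dr] <;> constructor <;> simp

theorem cyc_sep [Finite V] {S : G.Subgraph} (h : IsCyc S) :
    ∃ p q, p ∉ Φ.dr S ∧ q ∉ Φ.dr S ∧ ¬ NS (Φ.dr S) p q := by
  obtain ⟨a, ha⟩ := cyc_nonempty h
  obtain ⟨b, d, hbd, h1, h2⟩ := cyc_nbr h ha
  obtain ⟨p, hp, he, hS⟩ := cyc_decomp h h1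
  have hab := h1.adj_sub
  rw [hS, dr_sup, dr_edge]
  exact jct (ar_compact _) (dr_compact _) (ar_conn hab) (dr_conn (walk_sconn p)) (ar_logs hab)
    (path_logs p hp) (Φ.vmap_inj.ne hab.ne) (cyc_inter hab p he)

theorem cyc_closure [Finite V] {S : G.Subgraph} (h : IsCyc S) {p : ℝ × ℝ} (hp : p ∉ Φ.dr S) :
    Φ.dr S ⊆ closure (connectedComponentIn (Φ.dr S)ᶜ p) := by
  have key : ∀ a b, S.Adj a b → Φ.ar s(a, b) ⊆ closure (connectedComponentIn (Φ.dr S)ᶜ p) := by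
    intro a b hab
    obtain ⟨P, hP, he, hS⟩ := cyc_decomp h hab
    obtain ⟨f, h1, h2, h3, h4, h5⟩ := Φ.ar_param hab.adj_sub
    have hI := cyc_inter (Φ := Φ) hab.adj_sub P he
    have hS' : Φ.dr S = f '' Icc 0 1 ∪ Φ.dr P.toSubgraph := by
      rw [h3]
      conv_lhs => rw [hS]
      rw [dr_sup, dr_edge]
    rw [← h3, ← h4, ← h5] at hI
    rw [hS'] at hp ⊢
    rw [← h3]
    exact arc_closure h1 h2 (dr_compact _) (path_logs P hP) hI hp
  rintro z (⟨v, hv, rfl⟩ | ⟨e, he, hz⟩)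
  · obtain ⟨b, _, _, hb, _⟩ := cyc_nbr h hv
    exact key v b hb (left_ar hb.adj_sub)
  · induction e with
    | h u v => exact key u v he hz

end PlaneEmbedding

open Set Topology

theorem comp_sub {X : Type*} [TopologicalSpace X] {K : Set X} {p : X} {S : Set X}
    (hS : IsPreconnected S) (hd : ∀ z ∈ S, z ∉ K) {x : X} (hx : x ∈ S)
    (hxD : x ∈ connectedComponentIn Kᶜ p) : S ⊆ connectedComponentIn Kᶜ p := by
  rw [connectedComponentIn_eq hxD]
  exact hS.subset_connectedComponentIn hx hd

theorem comp_notMem {X : Type*} [TopologicalSpace X] {K : Set X} {p z : X}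
    (h : z ∈ connectedComponentIn Kᶜ p) : z ∉ K := connectedComponentIn_subset _ _ h

namespace PlaneEmbedding
open SimpleGraph
variable {V : Type*} {G : SimpleGraph V} {Φ : PlaneEmbedding G}

theorem edge_diff {C : G.Subgraph} {a b : V} (hab : G.Adj a b) (ha : a ∉ C.verts) :
    IsPreconnected (Φ.ar s(a, b) \ Φ.dr C) ∧ Φ.vmap a ∈ Φ.ar s(a, b) \ Φ.dr C := by
  refine ⟨?_, left_ar hab, fun h => ha (vmap_dr.1 h)⟩
  have key : ∀ z ∈ Φ.ar s(a, b), z ∈ Φ.dr C → z = Φ.vmap b ∧ b ∈ C.verts := by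
    intro z hz hzC
    by_cases h : ∃ x, Φ.vmap x = z
    · obtain ⟨x, rfl⟩ := h
      have h1 := vmap_dr.1 hzC
      rcases Sym2.mem_iff.1 (mem_of_vmap_ar hz) with rfl | rfl
      · exact absurd h1 ha
      · exact ⟨rfl, h1⟩
    · push Not at h
      exact absurd (C.edge_vert (nonvert_dr hz h hzC)) ha
  by_cases hb : b ∈ C.verts
  · have : Φ.ar s(a, b) \ Φ.dr C = Φ.ar s(a, b) \ {Φ.vmap b} := by
      ext z
      constructor
      · rintro ⟨h1, h2⟩
        refine ⟨h1, ?_⟩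
        rintro rfl
        exact h2 (vmap_dr.2 hb)
      · rintro ⟨h1, h2⟩
        exact ⟨h1, fun h => h2 (key z h1 h).1⟩
    rw [this]; exact ar_half hab
  · have : Φ.ar s(a, b) \ Φ.dr C = Φ.ar s(a, b) := by
      ext z
      exact ⟨fun h => h.1, fun h => ⟨h, fun h' => hb (key z h h').2⟩⟩
    rw [this]; exact ar_conn hab

theorem edge_prop {C : G.Subgraph} {p z : ℝ × ℝ} {a b : V} (hab : G.Adj a b) (ha : a ∉ C.verts)
    (hz : z ∈ Φ.ar s(a, b)) (hzD : z ∈ connectedComponentIn (Φ.dr C)ᶜ p) :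
    Φ.ar s(a, b) \ Φ.dr C ⊆ connectedComponentIn (Φ.dr C)ᶜ p :=
  comp_sub (edge_diff hab ha).1 (fun _ h => h.2) ⟨hz, comp_notMem hzD⟩ hzD

theorem first_hit {C : G.Subgraph} {p : ℝ × ℝ} {a w t : V} (hw : w ∉ C.verts)
    (hwD : Φ.vmap w ∈ connectedComponentIn (Φ.dr C)ᶜ p) (ht : t ∈ C.verts)
    (h : Relation.ReflTransGen (AvAdj G a a) w t) :
    ∃ x ∈ C.verts, x ≠ a ∧ Relation.ReflTransGen (fun u v => G.Adj u v ∧ u ∉ C.verts ∧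
      (v ∈ C.verts → v = x) ∧ Φ.ar s(u, v) \ Φ.dr C ⊆ connectedComponentIn (Φ.dr C)ᶜ p) w x := by
  induction h using Relation.ReflTransGen.head_induction_on with
  | refl => exact absurd ht hw
  | @head u v huv _ ih =>
    have hsub := edge_prop huv.1 hw (left_ar huv.1) hwD
    by_cases hv : v ∈ C.verts
    · exact ⟨v, hv, huv.2.2.1, Relation.ReflTransGen.single ⟨huv.1, hw, fun _ => rfl, hsub⟩⟩
    · have hvD := hsub ⟨right_ar huv.1, fun h => hv (vmap_dr.1 h)⟩
      obtain ⟨x, h1, h2, h3⟩ := ih hv hvD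
      exact ⟨x, h1, h2, Relation.ReflTransGen.head
        ⟨huv.1, hw, fun h => absurd h hv, hsub⟩ h3⟩

theorem ear (hT : Tri G) {C : G.Subgraph} (hC : IsCyc C) {p z : ℝ × ℝ}
    (hzD : z ∈ connectedComponentIn (Φ.dr C)ᶜ p) (hz : z ∈ Φ.dr ⊤) :
    ∃ x y : V, x ≠ y ∧ x ∈ C.verts ∧ y ∈ C.verts ∧ ∃ P : G.Walk x y, P.IsPath ∧
      (∀ z ∈ P.support, z ∈ C.verts → z = x ∨ z = y) ∧ (∀ e ∈ P.edges, e ∉ C.edgeSet) ∧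
      ∀ e ∈ P.edges, Φ.ar e \ Φ.dr C ⊆ connectedComponentIn (Φ.dr C)ᶜ p := by
  have case1 : ∀ w, w ∉ C.verts → Φ.vmap w ∈ connectedComponentIn (Φ.dr C)ᶜ p → 
     ∃ x y : V, x ≠ y ∧ x ∈ C.verts ∧ y ∈ C.verts ∧ ∃ P : G.Walk x y, P.IsPath ∧
      (∀ z ∈ P.support, z ∈ C.verts → z = x ∨ z = y) ∧ (∀ e ∈ P.edges, e ∉ C.edgeSet) ∧
      ∀ e ∈ P.edges, Φ.ar e \ Φ.dr C ⊆ connectedComponentIn (Φ.dr C)ᶜ p := by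
    intro w hw hwD
    obtain ⟨t, ht⟩ := cyc_nonempty hC
    obtain ⟨c, hc1, hc2⟩ := hT.2 w t
    obtain ⟨x, hx, -, hwx⟩ := first_hit hw hwD ht (hT.1 c c w t hc1.symm hc1.symm hc2.symm hc2.symm)
    obtain ⟨t', ht', htx, -⟩ := cyc_three hC x x
    have hwnx : w ≠ x := fun h => hw (h ▸ hx)
    obtain ⟨y, hy, hyx, hwy⟩ := first_hit hw hwD ht' (hT.1 x x w t' hwnx hwnx htx htx)
    let r : V → V → Prop := fun u v => G.Adj u v ∧ (u ∉ C.verts ∨ v ∉ C.verts) ∧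
      (u ∈ C.verts → u = x ∨ u = y) ∧ (v ∈ C.verts → v = x ∨ v = y) ∧
      Φ.ar s(u, v) \ Φ.dr C ⊆ connectedComponentIn (Φ.dr C)ᶜ p
    have hs : ∀ a b, r a b → r b a := by
      rintro a b ⟨h1, h2, h3, h4, h5⟩
      exact ⟨h1.symm, h2.symm, h4, h3, by rwa [Sym2.eq_swap]⟩
    have c1 : Relation.ReflTransGen r w x := rtg_mono (by
      rintro a b ⟨h1, h2, h3, h4⟩
      exact ⟨h1, Or.inl h2, fun h => absurd h h2, fun h => Or.inl (h3 h), h4⟩) hwx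
    have c2 : Relation.ReflTransGen r w y := rtg_mono (by
      rintro a b ⟨h1, h2, h3, h4⟩
      exact ⟨h1, Or.inl h2, fun h => absurd h h2, fun h => Or.inr (h3 h), h4⟩) hwy
    obtain ⟨P, hP, hPe⟩ := walk_of_rtg hs (fun _ _ h => h.1) ((rtg_symm hs c1).trans c2)
    refine ⟨x, y, hyx.symm, hx, hy, P, hP, ?_, ?_, ?_⟩
    · intro z hz hzC
      obtain ⟨v, hv⟩ := support_edge P hyx.symm hz
      exact (hPe _ _ hv).2.2.1 hzC
    · intro e he heC
      induction e with
      | h a b =>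
        rcases (hPe _ _ he).2.1 with h | h
        · exact h (C.edge_vert heC)
        · exact h (C.edge_vert (Subgraph.Adj.symm heC))
    · intro e he
      induction e with
      | h a b => exact (hPe _ _ he).2.2.2.2
  rcases hz with ⟨w, -, rfl⟩ | ⟨e, he, hz⟩
  · exact case1 w (fun h => comp_notMem hzD (vmap_dr.2 h)) hzD
  · induction e with
    | h a b =>
      have hab : G.Adj a b := he
      by_cases ha : a ∈ C.verts
      · by_cases hb : b ∈ C.verts
        · have hneC : s(a, b) ∉ C.edgeSet := fun h => comp_notMem hzD (ar_dr h hz)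
          refine ⟨a, b, hab.ne, ha, hb, Walk.cons hab Walk.nil, ?_, ?_, ?_, ?_⟩
          · rw [Walk.cons_isPath_iff]; exact ⟨by simp, by simpa using hab.ne⟩
          · intro z hz _
            simpa using hz
          · intro e he
            have : e = s(a, b) := by simpa using he
            rwa [this]
          · intro e he
            have : e = s(a, b) := by simpa using he
            rw [this]
            have hE : Φ.ar s(a, b) \ Φ.dr C = Φ.ar s(a, b) \ {Φ.vmap a, Φ.vmap b} := by
              ext w
              constructor
              · rintro ⟨h1, h2⟩
                refine ⟨h1, ?_⟩
                rintro (rfl | rfl)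
                · exact h2 (vmap_dr.2 ha)
                · exact h2 (vmap_dr.2 hb)
              · rintro ⟨h1, h2⟩
                refine ⟨h1, fun h => ?_⟩
                by_cases h' : ∃ x, Φ.vmap x = w
                · obtain ⟨x, rfl⟩ := h'
                  rcases Sym2.mem_iff.1 (mem_of_vmap_ar h1) with rfl | rfl
                  · exact h2 (Or.inl rfl)
                  · exact h2 (Or.inr rfl)
                · push Not at h'
                  exact hneC (nonvert_dr h1 h' h)
            have hpre : IsPreconnected (Φ.ar s(a, b) \ Φ.dr C) := by rw [hE]; exact ar_open hab
            exact comp_sub hpre (fun _ h => h.2) ⟨hz, comp_notMem hzD⟩ hzD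
        · have hba := hab.symm
          rw [Sym2.eq_swap] at hz
          exact case1 b hb (edge_prop hba hb hz hzD (edge_diff hba hb).2)
      · exact case1 a ha (edge_prop hab ha hz hzD (edge_diff hab ha).2)

theorem step (hT : Tri G) {C : G.Subgraph} (hC : IsCyc C) {p z : ℝ × ℝ}
    (hzD : z ∈ connectedComponentIn (Φ.dr C)ᶜ p) (hz : z ∈ Φ.dr ⊤) :
    ∃ P₁ P₂ P : G.Subgraph, P₁ ⊔ P₂ = C ∧ IsCyc (P₁ ⊔ P) ∧ IsCyc (P₂ ⊔ P) ∧
      (P₁ ⊔ P) ⊓ (P₂ ⊔ P) = P ∧ SConn P ∧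
      Φ.dr P ⊆ connectedComponentIn (Φ.dr C)ᶜ p ∪ Φ.dr C ∧
      ∃ e ∈ P.edgeSet, (Φ.ar e ∩ connectedComponentIn (Φ.dr C)ᶜ p).Nonempty := by
  obtain ⟨x, y, hxy, hx, hy, P, hP, h1, h2, h3⟩ := ear hT hC hzD hz
  obtain ⟨P₁, P₂, hP₁, hP₂, hS, hd, he⟩ := cyc_split hC hx hy hxy
  have v1 : ∀ z ∈ P₁.support, z ∈ C.verts := fun z hz => by
    rw [← hS]; exact Or.inl (by simpa using hz)
  have v2 : ∀ z ∈ P₂.support, z ∈ C.verts := fun z hz => by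
    rw [← hS]; exact Or.inr (by simpa using hz)
  have e1 : ∀ e ∈ P₁.edges, e ∈ C.edgeSet := fun z hz => by
    rw [← hS, Subgraph.edgeSet_sup]; exact Or.inl (by simpa using hz)
  have e2 : ∀ e ∈ P₂.edges, e ∈ C.edgeSet := fun z hz => by
    rw [← hS, Subgraph.edgeSet_sup]; exact Or.inr (by simpa using hz)
  refine ⟨P₁.toSubgraph, P₂.toSubgraph, P.toSubgraph, hS, ?_, ?_, ?_, walk_sconn P, ?_, ?_⟩
  · exact cyc_glue hxy hP₁ hP (fun z hz hz' => h1 z hz' (v1 z hz)) (fun e he he' => h2 e he' (e1 e he))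
  · exact cyc_glue hxy hP₂ hP (fun z hz hz' => h1 z hz' (v2 z hz)) (fun e he he' => h2 e he' (e2 e he))
  · rw [← sup_inf_right]
    apply sup_eq_right.2
    constructor
    · rintro z ⟨hz1, hz2⟩
      have := hd z (by simpa using hz1) (by simpa using hz2)
      rcases this with rfl | rfl <;> simp
    · rintro u v ⟨hz1, hz2⟩
      rw [Walk.adj_toSubgraph_iff_mem_edges] at hz1 hz2
      exact absurd hz2 (he _ hz1)
  · intro w hw
    by_cases hwC : w ∈ Φ.dr C
    · exact Or.inr hwC
    · left
      rcases hw with ⟨v, hv, rfl⟩ | ⟨e, he, hwe⟩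
      · obtain ⟨u, hu⟩ := support_edge P hxy (by simpa using hv)
        exact h3 _ hu ⟨left_ar (P.adj_of_mem_edges hu), hwC⟩
      · exact h3 e (by simpa using he) ⟨hwe, hwC⟩
  · obtain ⟨u, hu⟩ := support_edge P hxy P.start_mem_support
    obtain ⟨m, hm, hm'⟩ := ar_mid (Φ := Φ) (P.adj_of_mem_edges hu)
    refine ⟨s(x, u), by simpa using hu, m, hm, h3 _ hu ⟨hm, fun h => ?_⟩⟩
    exact h2 _ hu (nonvert_dr hm hm' h)

theorem fact1 [Finite V] {C A P₁ P : G.Subgraph} (hC : IsCyc C)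
    (hA : IsCyc A) (hAe : A = P₁ ⊔ P) (hP₁ : P₁ ≤ C) {p q r : ℝ × ℝ}
    (hP : Φ.dr P ⊆ connectedComponentIn (Φ.dr C)ᶜ p ∪ Φ.dr C)
    {e : Sym2 V} (he : e ∈ P.edgeSet) (heD : (Φ.ar e ∩ connectedComponentIn (Φ.dr C)ᶜ p).Nonempty)
    (hqC : q ∉ Φ.dr C) (hq : q ∉ connectedComponentIn (Φ.dr C)ᶜ p)
    (hr : r ∉ Φ.dr A) (hrq : ¬ NS (Φ.dr A) r q) :
    connectedComponentIn (Φ.dr A)ᶜ r ⊆ connectedComponentIn (Φ.dr C)ᶜ p ∧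
    ¬ (Φ.ar e ∩ connectedComponentIn (Φ.dr A)ᶜ r).Nonempty := by
  set D := connectedComponentIn (Φ.dr C)ᶜ p with hD
  set D' := connectedComponentIn (Φ.dr C)ᶜ q with hD'
  set E := connectedComponentIn (Φ.dr A)ᶜ r with hE
  have hdisj : ∀ z ∈ D', z ∉ D := by
    intro z hz hz'
    apply hq
    have : D' ⊆ D := comp_sub isPreconnected_connectedComponentIn
      (fun z hz => comp_notMem hz) hz hz'
    exact this (mem_connectedComponentIn hqC)
  have hPA : P ≤ A := hAe ▸ le_sup_right
  have hT : IsPreconnected (D' ∪ (Φ.dr C \ Φ.dr A)) := by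
    apply IsPreconnected.subset_closure (s := D') isPreconnected_connectedComponentIn
      subset_union_left
    exact union_subset subset_closure (sdiff_subset.trans (cyc_closure hC hqC))
  have hTA : ∀ z ∈ D' ∪ (Φ.dr C \ Φ.dr A), z ∉ Φ.dr A := by
    rintro z (hz | hz) hzA
    · rw [hAe, dr_sup] at hzA
      rcases hzA with h | h
      · exact comp_notMem hz (dr_mono hP₁ h)
      · rcases hP h with h | h
        · exact hdisj z hz h
        · exact comp_notMem hz h
    · exact hz.2 hzA
  have hqD' : q ∈ D' := mem_connectedComponentIn hqC
  have hET : ∀ z ∈ E, z ∉ D' ∪ (Φ.dr C \ Φ.dr A) := by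
    intro z hz hzT
    exact hrq ((NS.of_mem hr hz).trans (ns_of hT hTA hzT (Or.inl hqD')))
  have hEC : ∀ z ∈ E, z ∉ Φ.dr C := fun z hz hzC =>
    hET z hz (Or.inr ⟨hzC, comp_notMem hz⟩)
  obtain ⟨m, hm, hmD⟩ := heD
  have hmE : m ∈ closure E := cyc_closure hA hr (dr_mono hPA (ar_dr he hm))
  have hDo : IsOpen D := (dr_compact C).isClosed.isOpen_compl.connectedComponentIn
  obtain ⟨z, hzD, hzE⟩ := mem_closure_iff.1 hmE D hDo hmD
  refine ⟨comp_sub isPreconnected_connectedComponentIn hEC hzE hzD, ?_⟩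
  rintro ⟨w, hw, hwE⟩
  exact comp_notMem hwE (dr_mono hPA (ar_dr he hw))

noncomputable def cnt (Φ : PlaneEmbedding G) (D : Set (ℝ × ℝ)) : ℕ :=
  {e : Sym2 V | (Φ.ar e ∩ D).Nonempty}.ncard

theorem cnt_lt [Finite V] {D E : Set (ℝ × ℝ)} (h : E ⊆ D) {e : Sym2 V}
    (h1 : (Φ.ar e ∩ D).Nonempty) (h2 : ¬ (Φ.ar e ∩ E).Nonempty) : Φ.cnt E < Φ.cnt D := by
  apply Set.ncard_lt_ncard _ (Set.toFinite _)
  refine ⟨fun e he => he.mono (inter_subset_inter_right _ h), fun hs => h2 (hs h1)⟩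

theorem exists_other [Finite V] {C : G.Subgraph} (hC : IsCyc C) (q : ℝ × ℝ) :
    ∃ r, r ∉ Φ.dr C ∧ ¬ NS (Φ.dr C) r q := by
  obtain ⟨a, b, ha, hb, hab⟩ := cyc_sep (Φ := Φ) hC
  by_cases h : NS (Φ.dr C) a q
  · exact ⟨b, hb, fun h' => hab (h.trans h'.symm)⟩
  · exact ⟨a, ha, h⟩

theorem comp_terminal {C : G.Subgraph} {p : ℝ × ℝ} (hp : p ∉ Φ.dr C)
    (h : ∀ z ∈ connectedComponentIn (Φ.dr C)ᶜ p, z ∉ Φ.dr ⊤) :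
    connectedComponentIn (Φ.dr C)ᶜ p = connectedComponentIn (Φ.dr ⊤)ᶜ p := by
  have hm := mem_connectedComponentIn (F := (Φ.dr C)ᶜ) hp
  apply subset_antisymm
  · exact isPreconnected_connectedComponentIn.subset_connectedComponentIn hm h
  · exact connectedComponentIn_mono _ (compl_subset_compl.2 (dr_mono le_top))

theorem face_cycle_aux [Finite V] (hT : Tri G) {p : ℝ × ℝ} (hp : p ∉ Φ.dr ⊤) (n : ℕ) :
    ∀ C : G.Subgraph, IsCyc C → Φ.cnt (connectedComponentIn (Φ.dr C)ᶜ p) = n →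
    ∃ C' : G.Subgraph, IsCyc C' ∧
      connectedComponentIn (Φ.dr C')ᶜ p = connectedComponentIn (Φ.dr ⊤)ᶜ p := by
  induction n using Nat.strong_induction_on with
  | _ n ih =>
    intro C hC hn
    have hpn : ∀ S : G.Subgraph, p ∉ Φ.dr S := fun S h => hp (dr_mono le_top h)
    by_cases hD : ∀ z ∈ connectedComponentIn (Φ.dr C)ᶜ p, z ∉ Φ.dr ⊤
    · exact ⟨C, hC, comp_terminal (hpn C) hD⟩
    · push Not at hD
      obtain ⟨z, hz, hz'⟩ := hD
      obtain ⟨P₁, P₂, P, hS, hA, hB, hAB, hPc, hP, e, he, heD⟩ := step hT hC hz hz'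
      obtain ⟨q, hqC, hq⟩ := exists_other (Φ := Φ) hC p
      have hq' : q ∉ connectedComponentIn (Φ.dr C)ᶜ p := fun h => hq (NS.of_mem (hpn C) h).symm
      have hsep : ¬ NS (Φ.dr (P₁ ⊔ P)) p q ∨ ¬ NS (Φ.dr (P₂ ⊔ P)) p q := by
        by_contra hcon
        push Not at hcon
        apply hq
        have := jan (dr_compact _) (dr_compact _) (by rw [← dr_inf, hAB]; exact dr_conn hPc)
          hcon.1 hcon.2
        rw [← dr_sup] at this
        refine (this.mono (dr_mono ?_)).symm
        rw [← hS]
        exact sup_le_sup le_sup_left le_sup_left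
      rcases hsep with hsep | hsep
      · obtain ⟨f1, f2⟩ := fact1 hC hA rfl (hS ▸ le_sup_left) hP he heD hqC hq' (hpn _) hsep
        exact ih _ (hn ▸ cnt_lt f1 heD f2) _ hA rfl
      · obtain ⟨f1, f2⟩ := fact1 hC hB rfl (hS ▸ le_sup_right) hP he heD hqC hq' (hpn _) hsep
        exact ih _ (hn ▸ cnt_lt f1 heD f2) _ hB rfl

theorem face_cycle [Finite V] (hT : Tri G) {p : ℝ × ℝ} (hp : p ∉ Φ.dr ⊤) [Nonempty V] :
    ∃ C' : G.Subgraph, IsCyc C' ∧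
      connectedComponentIn (Φ.dr C')ᶜ p = connectedComponentIn (Φ.dr ⊤)ᶜ p := by
  obtain ⟨v⟩ := ‹Nonempty V›
  obtain ⟨C, hC, -⟩ := hT.cyc v
  exact face_cycle_aux hT hp _ C hC rfl

theorem vertex_face_aux [Finite V] (hT : Tri G) {v : V} (n : ℕ) :
    ∀ C : G.Subgraph, IsCyc C → v ∈ C.verts → ∀ p, p ∉ Φ.dr C →
      Φ.cnt (connectedComponentIn (Φ.dr C)ᶜ p) = n →
    ∃ p', p' ∉ Φ.dr ⊤ ∧ Φ.vmap v ∈ closure (connectedComponentIn (Φ.dr ⊤)ᶜ p') := by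
  induction n using Nat.strong_induction_on with
  | _ n ih =>
    intro C hC hv p hp hn
    by_cases hD : ∀ z ∈ connectedComponentIn (Φ.dr C)ᶜ p, z ∉ Φ.dr ⊤
    · refine ⟨p, hD p (mem_connectedComponentIn hp), ?_⟩
      rw [← comp_terminal hp hD]
      exact cyc_closure hC hp (vmap_dr.2 hv)
    · push Not at hD
      obtain ⟨z, hz, hz'⟩ := hD
      obtain ⟨P₁, P₂, P, hS, hA, hB, hAB, hPc, hP, e, he, heD⟩ := step hT hC hz hz'
      obtain ⟨q, hqC, hq⟩ := exists_other (Φ := Φ) hC p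
      have hq' : q ∉ connectedComponentIn (Φ.dr C)ᶜ p := fun h => hq (NS.of_mem hp h).symm
      have hv' : v ∈ P₁.verts ∨ v ∈ P₂.verts := by rw [← hS] at hv; exact hv
      rcases hv' with hv' | hv'
      · obtain ⟨r, hr, hrq⟩ := exists_other (Φ := Φ) hA q
        obtain ⟨f1, f2⟩ := fact1 hC hA rfl (hS ▸ le_sup_left) hP he heD hqC hq' hr hrq
        exact ih _ (hn ▸ cnt_lt f1 heD f2) _ hA (Or.inl hv') r hr rfl
      · obtain ⟨r, hr, hrq⟩ := exists_other (Φ := Φ) hB q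
        obtain ⟨f1, f2⟩ := fact1 hC hB rfl (hS ▸ le_sup_right) hP he heD hqC hq' hr hrq
        exact ih _ (hn ▸ cnt_lt f1 heD f2) _ hB (Or.inl hv') r hr rfl

theorem vertex_face [Finite V] (hT : Tri G) (v : V) :
    ∃ p', p' ∉ Φ.dr ⊤ ∧ Φ.vmap v ∈ closure (connectedComponentIn (Φ.dr ⊤)ᶜ p') := by
  obtain ⟨C, hC, hv⟩ := hT.cyc v
  obtain ⟨p, _, hp, _⟩ := cyc_sep (Φ := Φ) hC
  exact vertex_face_aux hT _ C hC hv p hp rfl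

theorem drawing_eq (hT : Tri G) : Φ.drawing = Φ.dr ⊤ := by
  ext z
  simp only [drawing, mem_iUnion]
  constructor
  · rintro ⟨⟨e, he⟩, hz⟩
    exact Or.inr ⟨e, by simpa using he, he, hz⟩
  · rintro (⟨v, -, rfl⟩ | ⟨e, -, he, hz⟩)
    · obtain ⟨c, hc, -⟩ := hT.2 v v
      obtain ⟨x, hx, -⟩ := hT.nbr v c hc.symm
      obtain ⟨h, h'⟩ := left_ar (Φ := Φ) hx
      exact ⟨⟨_, h⟩, h'⟩
    · exact ⟨⟨e, he⟩, hz⟩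

end PlaneEmbedding

open Set Topology

section G3
open SimpleGraph
variable {V : Type*} {G : SimpleGraph V}

/-- adjacency within a set -/
def AdjIn (G : SimpleGraph V) (s : Set V) (x y : V) : Prop := G.Adj x y ∧ x ∈ s ∧ y ∈ s

theorem AdjIn.symm' {s : Set V} : ∀ x y, AdjIn G s x y → AdjIn G s y x :=
  fun _ _ h => ⟨h.1.symm, h.2.2, h.2.1⟩

/-- induced subgraph on a set -/
def TS (G : SimpleGraph V) (s : Set V) : G.Subgraph := (⊤ : G.Subgraph).induce s

theorem TS_verts (s : Set V) : (TS G s).verts = s := rfl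

theorem TS_adj {s : Set V} {x y : V} : (TS G s).Adj x y ↔ AdjIn G s x y := by
  simp [TS, AdjIn]; tauto

theorem TS_inf (s t : Set V) : TS G s ⊓ TS G t = TS G (s ∩ t) := by
  ext x y
  · rfl
  · rw [Subgraph.inf_adj, TS_adj, TS_adj, TS_adj]
    simp only [AdjIn, mem_inter_iff]; tauto

theorem TS_conn {s : Set V} (h : ∀ u ∈ s, ∀ v ∈ s, Relation.ReflTransGen (AdjIn G s) u v) :
    SConn (TS G s) := fun u hu v hv => rtg_mono (fun _ _ h => TS_adj.2 h) (h u hu v hv)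

theorem sconn_sup {S T : G.Subgraph} (hS : SConn S) (hT : SConn T) {k : V} (h1 : k ∈ S.verts)
    (h2 : k ∈ T.verts) : SConn (S ⊔ T) := by
  have key : ∀ u ∈ (S ⊔ T).verts, Relation.ReflTransGen (S ⊔ T).Adj u k := by
    rintro u (hu | hu)
    · exact rtg_mono (fun _ _ h => Or.inl h) (hS u hu k h1)
    · exact rtg_mono (fun _ _ h => Or.inr h) (hT u hu k h2)
  intro u hu v hv
  exact (key u hu).trans (rtg_symm (fun _ _ h => Subgraph.Adj.symm h) (key v hv))

theorem cover2 {C : G.Subgraph} {s : Set V} (hs : C.verts ⊆ s) {a b : V} (hab : a ≠ b)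
    (hC : ¬ C.Adj a b) : C ≤ TS G (s \ {a}) ⊔ TS G (s \ {b}) := by
  constructor
  · intro x hx
    by_cases h : x = a
    · exact Or.inr ⟨hs hx, by subst h; exact hab⟩
    · exact Or.inl ⟨hs hx, h⟩
  · intro x y hxy
    rw [Subgraph.sup_adj, TS_adj, TS_adj]
    have h1 := hs (C.edge_vert hxy)
    have h2 := hs (C.edge_vert (Subgraph.Adj.symm hxy))
    have h3 := hxy.adj_sub
    by_cases ha : x = a ∨ y = a
    · right
      refine ⟨h3, ⟨h1, ?_⟩, ⟨h2, ?_⟩⟩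
      · rintro rfl
        rcases ha with rfl | rfl
        · exact hab rfl
        · exact hC (Subgraph.Adj.symm hxy)
      · rintro rfl
        rcases ha with rfl | rfl
        · exact hC hxy
        · exact hab rfl
    · push Not at ha
      exact Or.inl ⟨h3, ⟨h1, ha.1⟩, ⟨h2, ha.2⟩⟩

theorem cover3 {C : G.Subgraph} {s : Set V} (hs : C.verts ⊆ s) {a b c : V} (hab : a ≠ b)
    (hac : a ≠ c) (hbc : b ≠ c) :
    C ≤ (TS G (s \ {a}) ⊔ TS G (s \ {b})) ⊔ TS G (s \ {c}) := by
  constructor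
  · intro x hx
    by_cases h : x = a
    · exact Or.inl (Or.inr ⟨hs hx, by subst h; exact hab⟩)
    · exact Or.inl (Or.inl ⟨hs hx, h⟩)
  · intro x y hxy
    rw [Subgraph.sup_adj, Subgraph.sup_adj, TS_adj, TS_adj, TS_adj]
    have h1 := hs (C.edge_vert hxy)
    have h2 := hs (C.edge_vert (Subgraph.Adj.symm hxy))
    have h3 := hxy.adj_sub
    simp only [AdjIn, mem_sdiff, mem_singleton_iff]
    by_cases x = a <;> by_cases x = b <;> by_cases x = c <;> by_cases y = a <;> by_cases y = b
      <;> grind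

structure IsComp (C : G.Subgraph) (K : Set V) : Prop where
  disj : ∀ k ∈ K, k ∉ C.verts
  conn : ∀ k ∈ K, ∀ k' ∈ K, Relation.ReflTransGen (AdjIn G K) k k'
  closed : ∀ k ∈ K, ∀ y, G.Adj k y → y ∉ C.verts → y ∈ K

theorem exit_of_rtg {α : Type*} {r : α → α → Prop} {K : Set α} {u v : α}
    (h : Relation.ReflTransGen r u v) (hu : u ∈ K) (hv : v ∉ K) :
    ∃ x y, x ∈ K ∧ y ∉ K ∧ r x y := by
  induction h with
  | refl => exact absurd hu hv
  | @tail b c _ h ih =>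
    by_cases hb : b ∈ K
    · exact ⟨b, c, hb, hv, h⟩
    · exact ih hb

/-- attachment vertices -/
def NK (C : G.Subgraph) (K : Set V) : Set V := {y | y ∈ C.verts ∧ ∃ k ∈ K, G.Adj y k}

theorem IsComp.n3 (hT : Tri G) {C : G.Subgraph} (hC : IsCyc C) {K : Set V} (hK : IsComp C K)
    {k : V} (hk : k ∈ K) {a b : V} (ha : a ∈ C.verts) (hb : b ∈ C.verts) :
    ∃ d ∈ NK C K, d ≠ a ∧ d ≠ b := by
  obtain ⟨t, ht, hta, htb⟩ := cyc_three hC a b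
  have hka : k ≠ a := fun h => hK.disj k hk (h ▸ ha)
  have hkb : k ≠ b := fun h => hK.disj k hk (h ▸ hb)
  obtain ⟨x, y, hx, hy, h1, h2, h3⟩ := exit_of_rtg (hT.1 a b k t hka hkb hta htb) hk
    (fun h => hK.disj t h ht)
  refine ⟨y, ⟨?_, x, hx, h1.symm⟩, h3.1, h3.2⟩
  by_contra hyC
  exact hy (hK.closed x hx y h1 hyC)

theorem IsComp.reach (hT : Tri G) {C : G.Subgraph} {K : Set V} (hK : IsComp C K)
    {k : V} (hk : k ∈ K) {a b : V} (ha : a ∈ C.verts) (hb : b ∈ C.verts) {u : V}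
    (hu : u ∉ K) (hua : u ≠ a) (hub : u ≠ b) :
    ∃ d ∈ NK C K, d ≠ a ∧ d ≠ b ∧ Relation.ReflTransGen (AdjIn G (Kᶜ \ {a, b})) u d := by
  have hka : k ≠ a := fun h => hK.disj k hk (h ▸ ha)
  have hkb : k ≠ b := fun h => hK.disj k hk (h ▸ hb)
  have h := hT.1 a b u k hua hub hka hkb
  induction h using Relation.ReflTransGen.head_induction_on with
  | refl => exact absurd hk hu
  | @head x y hxy _ ih =>
    by_cases hy : y ∈ K
    · refine ⟨x, ⟨?_, y, hy, hxy.1⟩, hua, hub, Relation.ReflTransGen.refl⟩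
      by_contra hxC
      exact hu (hK.closed y hy x hxy.1.symm hxC)
    · obtain ⟨d, h1, h2, h3, h4⟩ := ih hy hxy.2.2.1 hxy.2.2.2
      refine ⟨d, h1, h2, h3, Relation.ReflTransGen.head ⟨hxy.1, ⟨hu, ?_⟩, ⟨hy, ?_⟩⟩ h4⟩
      · rintro (h | h)
        · exact hua h
        · exact hub h
      · rintro (h | h)
        · exact hxy.2.2.1 h
        · exact hxy.2.2.2 h

theorem IsComp.sconn (hT : Tri G) {C : G.Subgraph} {K : Set V} (hK : IsComp C K)
    {k : V} (hk : k ∈ K) {a b : V} (ha : a ∈ C.verts) (hb : b ∈ C.verts)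
    (h : ∀ d ∈ NK C K, d ≠ a → d ≠ b → ∀ d' ∈ NK C K, d' ≠ a → d' ≠ b →
      Relation.ReflTransGen (AdjIn G (Kᶜ \ {a, b})) d d') :
    SConn (TS G (Kᶜ \ {a, b})) := by
  apply TS_conn
  rintro u ⟨hu, hu'⟩ v ⟨hv, hv'⟩
  simp only [mem_insert_iff, mem_singleton_iff, not_or] at hu' hv'
  obtain ⟨d, h1, h2, h3, h4⟩ := hK.reach hT hk ha hb hu hu'.1 hu'.2
  obtain ⟨d', h1', h2', h3', h4'⟩ := hK.reach hT hk ha hb hv hv'.1 hv'.2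
  exact (h4.trans (h d h1 h2 h3 d' h1' h2' h3')).trans (rtg_symm AdjIn.symm' h4')

theorem IsComp.pair (hT : Tri G) {C : G.Subgraph} (hC : IsCyc C) {K : Set V} (hK : IsComp C K)
    {k : V} (hk : k ∈ K) {c : V} (hc : c ∈ C.verts) (hcN : c ∉ NK C K) :
    ∃ a ∈ NK C K, ∃ b ∈ NK C K, a ≠ b ∧ ¬ C.Adj a b ∧ SConn (TS G (Kᶜ \ {a, b})) := by
  classical
  obtain ⟨w, hw, rfl⟩ := cyc_start hC hc
  have hcne : ∀ x ∈ NK w.toSubgraph K, c ≠ x := by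
    intro x hx h
    rw [← h] at hx
    exact hcN hx
  set n := w.length with hn
  have hex : ∀ d ∈ NK w.toSubgraph K, ∃ i, w.getVert i = d ∧ i < n ∧ 0 < i := by
    rintro d hd0
    have hd := hd0.1
    rw [Walk.mem_verts_toSubgraph, Walk.mem_support_iff_exists_getVert] at hd
    obtain ⟨i, hi, hin⟩ := hd
    refine ⟨i, hi, lt_of_le_of_ne hin ?_, Nat.pos_of_ne_zero ?_⟩
    · rintro rfl
      rw [Walk.getVert_length] at hi
      exact hcne _ hd0 hi
    · rintro rfl
      rw [Walk.getVert_zero] at hi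
      exact hcne _ hd0 hi
  have hinj : ∀ i j, 0 < i → i ≤ n → 0 < j → j ≤ n → w.getVert i = w.getVert j → i = j := by
    intro i j h1 h2 h3 h4 h
    exact hw.getVert_injOn ⟨h1, h2⟩ ⟨h3, h4⟩ h
  let I : Finset ℕ := (Finset.range n).filter (fun i => w.getVert i ∈ NK w.toSubgraph K)
  have hI : I.Nonempty := by
    obtain ⟨d, hd, -⟩ := hK.n3 hT hC hk hc hc
    obtain ⟨i, hi, hin, -⟩ := hex d hd
    exact ⟨i, by simp only [I, Finset.mem_filter, Finset.mem_range]; exact ⟨hin, hi ▸ hd⟩⟩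
  have hpos : ∀ i ∈ I, 0 < i ∧ i < n ∧ w.getVert i ∈ NK w.toSubgraph K := by
    intro i hi
    simp only [I, Finset.mem_filter, Finset.mem_range] at hi
    refine ⟨Nat.pos_of_ne_zero ?_, hi⟩
    rintro rfl
    rw [Walk.getVert_zero] at hi
    exact hcN hi.2
  obtain ⟨i, hiI, hi⟩ := I.exists_min_image id hI
  obtain ⟨j, hjI, hj⟩ := I.exists_max_image id hI
  obtain ⟨i0, i1, i2⟩ := hpos i hiI
  obtain ⟨j0, j1, j2⟩ := hpos j hjI
  have hbet : ∀ d ∈ NK w.toSubgraph K, d ≠ w.getVert i → d ≠ w.getVert j →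
      ∃ l, w.getVert l = d ∧ i < l ∧ l < j := by
    intro d hd hdi hdj
    obtain ⟨l, hl, hln, hl0⟩ := hex d hd
    have hlI : l ∈ I := by
      simp only [I, Finset.mem_filter, Finset.mem_range]; exact ⟨hln, hl ▸ hd⟩
    have h1 : i ≤ l := hi l hlI
    have h2 : l ≤ j := hj l hlI
    refine ⟨l, hl, lt_of_le_of_ne h1 ?_, lt_of_le_of_ne h2 ?_⟩
    · rintro rfl; exact hdi hl.symm
    · rintro rfl; exact hdj hl.symm
  obtain ⟨d, hd, hdi, hdj⟩ := hK.n3 hT hC hk i2.1 j2.1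
  obtain ⟨l, hl, hil, hlj⟩ := hbet d hd hdi hdj
  refine ⟨w.getVert i, i2, w.getVert j, j2, ?_, ?_, ?_⟩
  · intro h
    have := hinj i j i0 i1.le j0 j1.le h
    omega
  · intro h
    rw [Walk.toSubgraph_adj_iff] at h
    obtain ⟨m, hm, hmn⟩ := h
    have hm0 : 0 < m := by
      by_contra hcon
      have hm0 : m = 0 := by omega
      subst hm0
      rw [Walk.getVert_zero] at hm
      have : c ∈ s(w.getVert i, w.getVert j) := by rw [← hm]; simp
      rcases Sym2.mem_iff.1 this with h | h
      · exact hcne _ i2 h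
      · exact hcne _ j2 h
    rcases Sym2.eq_iff.1 hm with ⟨h1, h2⟩ | ⟨h1, h2⟩
    · have := hinj _ _ hm0 (by omega) i0 i1.le h1
      have := hinj _ _ (by omega) (by omega) j0 j1.le h2
      omega
    · have := hinj _ _ hm0 (by omega) j0 j1.le h1
      have := hinj _ _ (by omega) (by omega) i0 i1.le h2
      omega
  · apply hK.sconn hT hk i2.1 j2.1
    have hin : ∀ x, i < x → x < j → w.getVert x ∈ Kᶜ \ {w.getVert i, w.getVert j} := by
      intro x h1 h2
      refine ⟨fun h => hK.disj _ h ?_, ?_⟩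
      · rw [Walk.mem_verts_toSubgraph]; exact w.getVert_mem_support x
      · rintro (h | h)
        · have := hinj _ _ (by omega) (by omega) i0 i1.le h
          omega
        · have := hinj _ _ (by omega) (by omega) j0 j1.le h
          omega
    have up : ∀ m x, i < x → x + m < j →
        Relation.ReflTransGen (AdjIn G (Kᶜ \ {w.getVert i, w.getVert j}))
          (w.getVert x) (w.getVert (x + m)) := by
      intro m
      induction m with
      | zero => intro x _ _; exact Relation.ReflTransGen.refl
      | succ m ih =>
        intro x h1 h2
        refine Relation.ReflTransGen.tail (ih x h1 (by omega)) ⟨?_, ?_, ?_⟩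
        · exact w.adj_getVert_succ (by omega)
        · exact hin _ (by omega) (by omega)
        · exact hin _ (by omega) (by omega)
    intro d hd hdi hdj d' hd' hdi' hdj'
    obtain ⟨x, rfl, x1, x2⟩ := hbet d hd hdi hdj
    obtain ⟨y, rfl, y1, y2⟩ := hbet d' hd' hdi' hdj'
    rcases le_total x y with h | h
    · obtain ⟨m, rfl⟩ := Nat.exists_eq_add_of_le h
      exact up m x x1 y2
    · obtain ⟨m, rfl⟩ := Nat.exists_eq_add_of_le h
      exact rtg_symm AdjIn.symm' (up m y y1 x2)

end G3

open Set Topology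

namespace PlaneEmbedding
open SimpleGraph
variable {V : Type*} {G : SimpleGraph V} {Φ : PlaneEmbedding G}

theorem reach_face [Finite V] {C : G.Subgraph} (hC : IsCyc C) {p : ℝ × ℝ} (hp : p ∉ Φ.dr C)
    (hF : ∀ z ∈ connectedComponentIn (Φ.dr C)ᶜ p, z ∉ Φ.dr ⊤) {T : G.Subgraph} {x : V}
    (hx : x ∈ C.verts) (hxT : x ∉ T.verts) : NS (Φ.dr T) p (Φ.vmap x) := by
  have hpre : IsPreconnected (insert (Φ.vmap x) (connectedComponentIn (Φ.dr C)ᶜ p)) := by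
    refine isPreconnected_connectedComponentIn.subset_closure (subset_insert _ _) ?_
    exact insert_subset (cyc_closure hC hp (vmap_dr.2 hx)) subset_closure
  refine ns_of hpre ?_ (mem_insert_of_mem _ (mem_connectedComponentIn hp)) (mem_insert _ _)
  rintro z (rfl | hz)
  · exact fun h => hxT (vmap_dr.1 h)
  · exact fun h => hF z hz (dr_mono le_top h)

theorem ns_edge {T : G.Subgraph} {x y : V} (hxy : G.Adj x y) (hx : x ∉ T.verts) {m : ℝ × ℝ}
    (hm : m ∈ Φ.ar s(x, y)) (hmT : m ∉ Φ.dr T) : NS (Φ.dr T) (Φ.vmap x) m :=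
  ns_of (edge_diff hxy hx).1 (fun _ h => h.2) (edge_diff hxy hx).2 ⟨hm, hmT⟩

theorem chordless [Finite V] (hT : Tri G) {C : G.Subgraph} (hC : IsCyc C) {p : ℝ × ℝ}
    (hp : p ∉ Φ.dr C)
    (hF : ∀ z ∈ connectedComponentIn (Φ.dr C)ᶜ p, z ∉ Φ.dr ⊤) {u v : V} (hu : u ∈ C.verts)
    (hv : v ∈ C.verts) (huv : G.Adj u v) : C.Adj u v := by
  by_contra hn
  obtain ⟨m, hm, hmv⟩ := Φ.ar_mid huv
  have key : ∀ T : G.Subgraph, u ∉ T.verts ∨ v ∉ T.verts → m ∉ Φ.dr T := by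
    intro T h hmT
    have he : T.Adj u v := nonvert_dr hm hmv hmT
    rcases h with h | h
    · exact h (T.edge_vert he)
    · exact h (T.edge_vert (Subgraph.Adj.symm he))
  have h1 : NS (Φ.dr (TS G (univ \ {u}))) p m := by
    have hnu : u ∉ (TS G (univ \ {u})).verts := by simp [TS_verts]
    exact (reach_face hC hp hF hu hnu).trans (ns_edge huv hnu hm (key _ (Or.inl hnu)))
  have h2 : NS (Φ.dr (TS G (univ \ {v}))) p m := by
    have hnu : v ∉ (TS G (univ \ {v})).verts := by simp [TS_verts]
    exact (reach_face hC hp hF hv hnu).trans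
      (ns_edge huv.symm hnu (by rw [Sym2.eq_swap]; exact hm) (key _ (Or.inr hnu)))
  have hcon : SConn (TS G (univ \ {u} ∩ (univ \ {v}))) := by
    apply TS_conn
    intro x hx y hy
    simp only [mem_inter_iff, mem_sdiff, mem_univ, true_and, mem_singleton_iff] at hx hy
    refine rtg_mono ?_ (hT.1 u v x y hx.1 hx.2 hy.1 hy.2)
    rintro a b ⟨h, h1, h2⟩
    exact ⟨h, ⟨⟨trivial, h1.1⟩, ⟨trivial, h1.2⟩⟩, ⟨⟨trivial, h2.1⟩, ⟨trivial, h2.2⟩⟩⟩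
  have h3 := jan (dr_compact _) (dr_compact _)
    (by rw [← dr_inf, TS_inf]; exact dr_conn hcon) h1 h2
  rw [← dr_sup] at h3
  have h4 := h3.mono (dr_mono (cover2 (subset_univ C.verts) huv.ne hn))
  exact hF m h4.mem (ar_dr (S := ⊤) huv hm)

theorem kns [Finite V] {C : G.Subgraph} (hC : IsCyc C) {p : ℝ × ℝ} (hp : p ∉ Φ.dr C)
    (hF : ∀ z ∈ connectedComponentIn (Φ.dr C)ᶜ p, z ∉ Φ.dr ⊤) {K : Set V} (hK : IsComp C K)
    {T : G.Subgraph} (hTK : ∀ k ∈ K, k ∉ T.verts) {a : V} (ha : a ∈ NK C K) (haT : a ∉ T.verts)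
    {k : V} (hk : k ∈ K) : NS (Φ.dr T) p (Φ.vmap k) := by
  obtain ⟨haC, k1, hk1, hak⟩ := ha
  refine ((reach_face hC hp hF haC haT).trans (ns_edge hak haT (right_ar hak)
    (fun h => hTK k1 hk1 (vmap_dr.1 h)))).trans ?_
  refine ns_chain ?_ (fun h => hTK k1 hk1 (vmap_dr.1 h)) (hK.conn k1 hk1 k hk)
  rintro u v ⟨h, h1, h2⟩
  refine ⟨h, fun z hz hzT => ?_⟩
  by_cases hv : ∃ x, Φ.vmap x = z
  · obtain ⟨x, rfl⟩ := hv
    have := mem_of_vmap_ar hz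
    rcases Sym2.mem_iff.1 this with rfl | rfl
    · exact hTK _ h1 (vmap_dr.1 hzT)
    · exact hTK _ h2 (vmap_dr.1 hzT)
  · push Not at hv
    have he : T.Adj u v := nonvert_dr hz hv hzT
    exact hTK _ h1 (T.edge_vert he)

theorem kcontra {C : G.Subgraph} {p : ℝ × ℝ}
    (hF : ∀ z ∈ connectedComponentIn (Φ.dr C)ᶜ p, z ∉ Φ.dr ⊤) {k : V}
    (h : NS (Φ.dr C) p (Φ.vmap k)) : False :=
  hF _ h.mem (vmap_dr.2 trivial)

theorem attach_all [Finite V] (hT : Tri G) {C : G.Subgraph} (hC : IsCyc C) {p : ℝ × ℝ}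
    (hp : p ∉ Φ.dr C)
    (hF : ∀ z ∈ connectedComponentIn (Φ.dr C)ᶜ p, z ∉ Φ.dr ⊤) {K : Set V} (hK : IsComp C K)
    {k : V} (hk : k ∈ K) {c : V} (hc : c ∈ C.verts) : c ∈ NK C K := by
  by_contra hcN
  obtain ⟨a, ha, b, hb, hab, hn, hS⟩ := hK.pair hT hC hk hc hcN
  have hd : ∀ c : V, ∀ k ∈ K, k ∉ (TS G (Kᶜ \ {c})).verts := fun c k hk h => h.1 hk
  have hs : ∀ c : V, c ∉ (TS G (Kᶜ \ {c})).verts := fun c h => h.2 rfl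
  have h1 := kns hC hp hF hK (hd a) ha (hs a) hk
  have h2 := kns hC hp hF hK (hd b) hb (hs b) hk
  have he : Kᶜ \ {a} ∩ (Kᶜ \ {b}) = Kᶜ \ {a, b} := by
    ext x; simp only [mem_inter_iff, mem_sdiff, mem_insert_iff, mem_singleton_iff]; tauto
  have h3 := jan (dr_compact _) (dr_compact _)
    (by rw [← dr_inf, TS_inf, he]; exact dr_conn hS) h1 h2
  rw [← dr_sup] at h3
  exact kcontra hF (h3.mono (dr_mono (cover2 (fun x hx hxK => hK.disj x hxK hx) hab hn)))

theorem one_comp [Finite V] (hT : Tri G) {C : G.Subgraph} (hC : IsCyc C) {p : ℝ × ℝ}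
    (hp : p ∉ Φ.dr C)
    (hF : ∀ z ∈ connectedComponentIn (Φ.dr C)ᶜ p, z ∉ Φ.dr ⊤) {K K' : Set V} (hK : IsComp C K)
    (hK' : IsComp C K') (hdis : ∀ x ∈ K, x ∉ K') {k k' : V} (hk : k ∈ K) (hk' : k' ∈ K') :
    False := by
  obtain ⟨a, ha⟩ := cyc_nonempty hC
  obtain ⟨b, hb, hba, -⟩ := cyc_three hC a a
  obtain ⟨c, hc, hca, hcb⟩ := cyc_three hC a b
  have hN : ∀ x ∈ C.verts, x ∈ NK C K := fun x hx => attach_all hT hC hp hF hK hk hx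
  have hN' : ∀ x ∈ C.verts, x ∈ NK C K' := fun x hx => attach_all hT hC hp hF hK' hk' hx
  have hsub : ∀ x y, x ∈ C.verts → y ∈ C.verts → ∀ z ∈ K', z ∈ Kᶜ \ {x, y} := by
    intro x y hx hy z hz
    refine ⟨fun h => hdis z h hz, ?_⟩
    rintro (h | h)
    · exact hK'.disj z hz (h ▸ hx)
    · exact hK'.disj z hz (h ▸ hy)
  have hS : ∀ x y, x ∈ C.verts → y ∈ C.verts → SConn (TS G (Kᶜ \ {x} ∩ (Kᶜ \ {y}))) := by
    intro x y hx hy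
    have he : Kᶜ \ {x} ∩ (Kᶜ \ {y}) = Kᶜ \ {x, y} := by
      ext x; simp only [mem_inter_iff, mem_sdiff, mem_insert_iff, mem_singleton_iff]; tauto
    rw [he]
    apply hK.sconn hT hk hx hy
    intro d hd hdx hdy d' hd' hdx' hdy'
    obtain ⟨-, z, hz, hdz⟩ := hN' d hd.1
    obtain ⟨-, z', hz', hdz'⟩ := hN' d' hd'.1
    have hm : ∀ d ∈ NK C K, d ≠ x → d ≠ y → d ∈ Kᶜ \ {x, y} := by
      intro d hd h1 h2
      refine ⟨fun h => hK.disj d h hd.1, ?_⟩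
      rintro (h | h)
      · exact h1 h
      · exact h2 h
    have hmid := rtg_mono (r' := AdjIn G (Kᶜ \ {x, y}))
      (fun u v h => ⟨h.1, hsub x y hx hy u h.2.1, hsub x y hx hy v h.2.2⟩)
      (hK'.conn z hz z' hz')
    exact Relation.ReflTransGen.head ⟨hdz, hm d hd hdx hdy, hsub x y hx hy z hz⟩
      (hmid.tail ⟨hdz'.symm, hsub x y hx hy z' hz', hm d' hd' hdx' hdy'⟩)
  have hd : ∀ c : V, ∀ k ∈ K, k ∉ (TS G (Kᶜ \ {c})).verts := fun c k hk h => h.1 hk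
  have hs : ∀ c : V, c ∉ (TS G (Kᶜ \ {c})).verts := fun c h => h.2 rfl
  have h1 := fun x hx => kns hC hp hF hK (hd x) (hN x hx) (hs x) hk
  have h3 := jan (dr_compact _) (dr_compact _)
    (by rw [← dr_inf, TS_inf]; exact dr_conn (hS a b ha hb)) (h1 a ha) (h1 b hb)
  rw [← dr_sup] at h3
  have hin : ∀ x ∈ C.verts, ∀ y ∈ C.verts, k' ∈ (TS G (Kᶜ \ {x} ∩ (Kᶜ \ {y}))).verts := by
    intro x hx y hy
    have := hsub x y hx hy k' hk'
    simp only [mem_sdiff, mem_insert_iff, mem_singleton_iff, not_or] at this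
    exact ⟨⟨this.1, this.2.1⟩, ⟨this.1, this.2.2⟩⟩
  have h4 := jan (dr_compact _) (dr_compact _)
    (by
      rw [← dr_inf, inf_sup_right, TS_inf, TS_inf]
      exact dr_conn (sconn_sup (hS a c ha hc) (hS b c hb hc) (hin a ha c hc) (hin b hb c hc)))
    h3 (h1 c hc)
  rw [← dr_sup] at h4
  exact kcontra hF (h4.mono (dr_mono (cover3 (fun x hx hxK => hK.disj x hxK hx) hba.symm
    hca.symm hcb.symm)))

theorem nonsep [Finite V] (hT : Tri G) {C : G.Subgraph} (hC : IsCyc C) {p : ℝ × ℝ}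
    (hp : p ∉ Φ.dr C)
    (hF : ∀ z ∈ connectedComponentIn (Φ.dr C)ᶜ p, z ∉ Φ.dr ⊤) {w w' : V} (hw : w ∉ C.verts)
    (hw' : w' ∉ C.verts) : Relation.ReflTransGen (AdjIn G C.vertsᶜ) w w' := by
  by_contra hn
  have hcomp : ∀ u, u ∉ C.verts →
      IsComp C {z | Relation.ReflTransGen (AdjIn G C.vertsᶜ) u z} := by
    intro u hu
    have hd : ∀ z, Relation.ReflTransGen (AdjIn G C.vertsᶜ) u z → z ∉ C.verts := by
      intro z hz
      cases hz with
      | refl => exact hu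
      | tail _ h => exact h.2.2
    have hst : ∀ z, Relation.ReflTransGen (AdjIn G C.vertsᶜ) u z →
        Relation.ReflTransGen (AdjIn G {z | Relation.ReflTransGen (AdjIn G C.vertsᶜ) u z}) u z := by
      intro z hz
      induction hz with
      | refl => exact Relation.ReflTransGen.refl
      | tail h1 h2 ih => exact ih.tail ⟨h2.1, h1, h1.tail h2⟩
    refine ⟨hd, fun k hk k' hk' => (rtg_symm AdjIn.symm' (hst k hk)).trans (hst k' hk'), ?_⟩
    intro k hk y hky hy
    exact Relation.ReflTransGen.tail hk ⟨hky, hd k hk, hy⟩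
  refine one_comp hT hC hp hF (hcomp w hw) (hcomp w' hw') (fun x hx hx' => hn ?_)
    (k := w) (k' := w') Relation.ReflTransGen.refl Relation.ReflTransGen.refl
  exact Relation.ReflTransGen.trans hx (rtg_symm AdjIn.symm' hx')

theorem bounds_face [Finite V] {C : G.Subgraph} (hC : IsCyc C)
    (hch : ∀ u ∈ C.verts, ∀ v ∈ C.verts, G.Adj u v → C.Adj u v)
    (hns : ∀ w, w ∉ C.verts → ∀ w', w' ∉ C.verts →
      Relation.ReflTransGen (AdjIn G C.vertsᶜ) w w') :
    ∃ r, r ∉ Φ.dr C ∧ ∀ z ∈ connectedComponentIn (Φ.dr C)ᶜ r, z ∉ Φ.dr ⊤ := by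
  have key : ∀ z, z ∈ Φ.dr ⊤ → z ∉ Φ.dr C → ∃ w, w ∉ C.verts ∧ NS (Φ.dr C) (Φ.vmap w) z := by
    rintro z (⟨v, -, rfl⟩ | ⟨e, he, hz⟩) hzC
    · exact ⟨v, fun h => hzC (vmap_dr.2 h), NS.refl' hzC⟩
    · induction e with
      | h u v =>
        have huv : G.Adj u v := by simpa using he
        by_cases hu : u ∈ C.verts
        · by_cases hv : v ∈ C.verts
          · exact absurd (ar_dr (S := C) (hch u hu v hv huv) hz) hzC
          · exact ⟨v, hv, ns_edge huv.symm hv (by rw [Sym2.eq_swap]; exact hz) hzC⟩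
        · exact ⟨u, hu, ns_edge huv hu hz hzC⟩
  have key2 : ∀ z, z ∈ Φ.dr ⊤ → z ∉ Φ.dr C → ∀ z', z' ∈ Φ.dr ⊤ → z' ∉ Φ.dr C →
      NS (Φ.dr C) z z' := by
    intro z h1 h2 z' h1' h2'
    obtain ⟨w, hw, hwz⟩ := key z h1 h2
    obtain ⟨w', hw', hwz'⟩ := key z' h1' h2'
    refine (hwz.symm.trans ?_).trans hwz'
    refine ns_chain ?_ (fun h => hw (vmap_dr.1 h)) (hns w hw w' hw')
    rintro u v ⟨h, hu, hv⟩
    refine ⟨h, fun z hz hzT => ?_⟩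
    by_cases hx : ∃ x, Φ.vmap x = z
    · obtain ⟨x, rfl⟩ := hx
      have := mem_of_vmap_ar hz
      rcases Sym2.mem_iff.1 this with rfl | rfl
      · exact hu (vmap_dr.1 hzT)
      · exact hv (vmap_dr.1 hzT)
    · push Not at hx
      have he : C.Adj u v := nonvert_dr hz hx hzT
      exact hu (C.edge_vert he)
  by_cases hz : ∃ z0, z0 ∈ Φ.dr ⊤ ∧ z0 ∉ Φ.dr C
  · obtain ⟨z0, h1, h2⟩ := hz
    obtain ⟨r, hr, hrz⟩ := exists_other (Φ := Φ) hC z0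
    refine ⟨r, hr, fun z hz hz' => hrz ?_⟩
    exact (NS.of_mem hr hz).trans (key2 z hz' (comp_notMem hz) z0 h1 h2)
  · push Not at hz
    obtain ⟨r, _, hr, _⟩ := cyc_sep (Φ := Φ) hC
    exact ⟨r, hr, fun z h h' => comp_notMem h (hz z h')⟩

theorem onFace_of [Finite V] (hT : Tri G) {p : ℝ × ℝ} {v : V}
    (h : Φ.vmap v ∈ closure (connectedComponentIn (Φ.dr ⊤)ᶜ p)) :
    Φ.OnFace (connectedComponentIn (Φ.dr ⊤)ᶜ p) v := by
  refine ⟨h, fun h' => ?_⟩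
  exact comp_notMem (interior_subset h') (vmap_dr.2 trivial)

theorem isFace_of (hT : Tri G) {p : ℝ × ℝ} (hp : p ∉ Φ.dr ⊤) :
    Φ.IsFace (connectedComponentIn (Φ.dr ⊤)ᶜ p) := by
  rw [← drawing_eq hT] at hp ⊢
  exact ⟨p, hp, rfl⟩

theorem transfer [Finite V] [Nonempty V] (hT : Tri G) (Φ' : PlaneEmbedding G)
    {F' : Set (ℝ × ℝ)} (hF' : Φ'.IsFace F') :
    ∃ F, Φ.IsFace F ∧ ∀ v, Φ'.OnFace F' v → Φ.OnFace F v := by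
  obtain ⟨p, hp, rfl⟩ := hF'
  rw [drawing_eq hT] at hp ⊢
  obtain ⟨C, hC, he⟩ := face_cycle hT hp
  have hpC : p ∉ Φ'.dr C := fun h => hp (dr_mono le_top h)
  have hF : ∀ z ∈ connectedComponentIn (Φ'.dr C)ᶜ p, z ∉ Φ'.dr ⊤ := by
    intro z hz
    rw [he] at hz
    exact comp_notMem hz
  obtain ⟨r, hr, hrF⟩ := bounds_face (Φ := Φ) hC
    (fun u hu v hv => chordless hT hC hpC hF hu hv)
    (fun w hw w' hw' => nonsep hT hC hpC hF hw hw')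
  refine ⟨_, isFace_of hT (hrF r (mem_connectedComponentIn hr)), fun v hv => onFace_of hT ?_⟩
  rw [← comp_terminal hr hrF]
  apply cyc_closure hC hr
  rw [vmap_dr]
  unfold OnFace at hv
  rw [← he] at hv
  exact vmap_dr.1 (frontier_comp (dr_compact C).isClosed hv)

end PlaneEmbedding

/-- for a finite simple triconnected planar graph `G` with families
`C 1, …, C q` of vertex subsets and any plane embedding `Φ` of `G`: `G` satisfies the
sequence `C` iff `ACF(Φ, C i)` is nonempty for every `i`, where each family `C i` is
regarded as a vf-family whose vf-sets contain only vertices. -/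
theorem statement8 {V : Type*} [Fintype V] (G : SimpleGraph V) (hG : Triconnected G)
    (q : ℕ) (C : Fin q → Set (Set V)) (Φ : PlaneEmbedding G) :
    (∃ Φ' : PlaneEmbedding G, ∀ i : Fin q, Φ'.SatisfiesFam (C i)) ↔
      (∀ i : Fin q,
        ((ACF (fun U : ↥(C i) => (⟨(U : Set V), ∅, by simp⟩ : VFSet Φ))).verts.Nonempty ∨
         (ACF (fun U : ↥(C i) => (⟨(U : Set V), ∅, by simp⟩ : VFSet Φ))).faces.Nonempty)) := by
  have hT := hG.tri
  haveI : Nonempty V := hG.1.1.nonempty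
  constructor
  · rintro ⟨Φ', h⟩ i
    obtain ⟨F', hF', hU⟩ := h i
    obtain ⟨F, hF, hFF⟩ := PlaneEmbedding.transfer (Φ := Φ) hT Φ' hF'
    by_cases hl : (ACF (fun U : ↥(C i) => (⟨(U : Set V), ∅, by simp⟩ : VFSet Φ))).verts.Nonempty
    · exact Or.inl hl
    · refine Or.inr ⟨F, hF, fun U => Or.inr ?_⟩
      obtain ⟨v, hv, hvF⟩ := hU U U.2
      exact ⟨v, hv, fun hvl => hl ⟨v, hvl⟩, hFF v hvF⟩
  · intro h
    refine ⟨Φ, fun i => ?_⟩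
    rcases h i with ⟨v, hv⟩ | ⟨F, hF, hU⟩
    · obtain ⟨p, hp, hcl⟩ := PlaneEmbedding.vertex_face (Φ := Φ) hT v
      refine ⟨_, PlaneEmbedding.isFace_of hT hp, fun U hU => ⟨v, ?_, PlaneEmbedding.onFace_of hT hcl⟩⟩
      exact mem_iInter.1 hv ⟨U, hU⟩
    · refine ⟨F, hF, fun U hUC => ?_⟩
      rcases hU ⟨U, hUC⟩ with h | ⟨v, hv, -, hvF⟩
      · exact absurd h (notMem_empty _)
      · exact ⟨v, hv, hvF⟩
end

section
/- Let H be a finite simple graph with a fixed plane embedding, and let 𝒟 = {S₁,…,S_d} be a vf-family of H with d ≥ 1. Let 𝒟_ℓ = {S₁,…,S_{⌈d/2⌉}} and 𝒟_r = {S_{⌈d/2⌉+1},…,S_d} (with 𝒟_r possibly empty only when d = 1; assume d ≥ 2 so that both are nonempty). Then ACF(H,𝒟) = ACF(H, {ACF(H,𝒟_ℓ), ACF(H,𝒟_r)}). -/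
open Set Topology

theorem acf_split {V : Type*} {G : SimpleGraph V} {Φ : PlaneEmbedding G} {ι : Type*}
    {κ : Bool → Type*} (D : ι → VFSet Φ) (f : (b : Bool) → κ b → ι)
    (hf : ∀ i, ∃ b k, f b k = i) (E : Bool → VFSet Φ)
    (hE : ∀ b, E b = ACF (fun k => D (f b k))) : ACF D = ACF E := by
  have hsub : ∀ b v, v ∈ lamV D → v ∈ lamV (fun k => D (f b k)) := by
    intro b v hv
    simp only [lamV, mem_iInter] at hv ⊢
    exact fun k => hv _
  have hV : lamV E = lamV D := by
    ext v
    constructor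
    · intro h
      simp only [lamV, mem_iInter] at h ⊢
      intro i
      obtain ⟨b, k, rfl⟩ := hf i
      have h1 := h b
      rw [hE] at h1
      simp only [ACF, lamV, mem_iInter] at h1
      exact h1 k
    · intro h
      refine mem_iInter.2 fun b => ?_
      rw [hE]
      exact hsub b v h
  have hF : lamF D = lamF E := by
    ext F
    constructor
    · rintro ⟨hF, h⟩
      refine ⟨hF, fun b => ?_⟩
      rw [hV, hE]
      by_cases hc : ∃ v ∈ lamV (fun k => D (f b k)), v ∉ lamV D ∧ Φ.OnFace F v
      · exact Or.inr hc
      · refine Or.inl ⟨hF, fun k => ?_⟩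
        rcases h (f b k) with h1 | ⟨v, hv, hn, ho⟩
        · exact Or.inl h1
        · exact Or.inr ⟨v, hv, fun hl => hc ⟨v, hl, hn, ho⟩, ho⟩
    · rintro ⟨hF, h⟩
      refine ⟨hF, fun i => ?_⟩
      obtain ⟨b, k, rfl⟩ := hf i
      have h1 := h b
      rw [hV, hE] at h1
      rcases h1 with h1 | ⟨v, hv, hn, ho⟩
      · rcases h1.2 k with h2 | ⟨v, hv, hn, ho⟩
        · exact Or.inl h2
        · exact Or.inr ⟨v, hv, fun hl => hn (hsub b v hl), ho⟩
      · exact Or.inr ⟨v, mem_iInter.1 hv k, hn, ho⟩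
  simp only [ACF, hV, hF]

/-- for a vf-family `D = {S_1, …, S_d}` (`d ≥ 2`) of a finite simple plane
graph, splitting `D` into its first `⌈d/2⌉` sets `D_ℓ` and remaining sets `D_r`,
`ACF(H, D) = ACF(H, {ACF(H, D_ℓ), ACF(H, D_r)})`. -/
theorem statement9 {V : Type*} [Fintype V] (G : SimpleGraph V) (Φ : PlaneEmbedding G)
    (d : ℕ) (hd : 2 ≤ d) (D : Fin d → VFSet Φ) :
    ACF D =
      ACF (fun b : Bool =>
        if b then
          ACF (fun i : Fin ((d + 1) / 2) => D ⟨i.1, by have := i.2; omega⟩)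
        else
          ACF (fun i : Fin (d - (d + 1) / 2) => D ⟨(d + 1) / 2 + i.1, by have := i.2; omega⟩)) := by
  refine acf_split (κ := fun b => Fin (if b then (d + 1) / 2 else d - (d + 1) / 2)) D
    (fun b => match b with
      | true => fun i => ⟨i.1, by have : i.1 < (d + 1) / 2 := i.2; omega⟩
      | false => fun i => ⟨(d + 1) / 2 + i.1, by have : i.1 < d - (d + 1) / 2 := i.2; omega⟩) ?_ _ ?_
  · intro i
    by_cases h : i.1 < (d + 1) / 2
    · exact ⟨true, ⟨i.1, by simpa using h⟩, rfl⟩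
    · refine ⟨false, ⟨i.1 - (d + 1) / 2, ?_⟩, ?_⟩
      · have := i.2
        simp
        omega
      · apply Fin.ext
        simp only
        omega
  · intro b
    cases b <;> rfl
end
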